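/- Let d = 2^ℓ, let ε, δ ∈ (0, 1/2), and let f : ℝ → ℝ be a 1-Lipschitz function. There is an absolute constant C > 0 such that if m ≥ C ε⁻² log⁵(d/ε) log(1/δ), then with probability at least 1 − δ over the random diagonal matrices, for every z ∈ ℝ^d with ‖z‖ ≤ 1, |(1/(md)) Σ_{j=1}^m Σ_{k=1}^d f(h̃_{j,k}(z)) − E_{Z ∼ N(0, ‖z‖²)}[f(Z)]| ≤ ε. -/

import Mathlib

open MeasureTheory ProbabilityTheory Real
open scoped ENNReal NNReal Classical

noncomputable section

/-- The Sylvester–Hadamard matrix of size `2^ℓ`: `H 0 = [1]`,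
`H (ℓ+1) = [[H ℓ, H ℓ],[H ℓ, -H ℓ]]`. -/
def Had : ∀ ℓ : ℕ, Matrix (Fin (2 ^ ℓ)) (Fin (2 ^ ℓ)) ℝ
  | 0 => 1
  | (ℓ + 1) =>
      Matrix.reindex (finSumFinEquiv.trans (finCongr (by rw [pow_succ, mul_two])))
        (finSumFinEquiv.trans (finCongr (by rw [pow_succ, mul_two])))
        (Matrix.fromBlocks (Had ℓ) (Had ℓ) (Had ℓ) (-(Had ℓ)))

/-- `rht ℓ m D z j k = (H_d D^j z)_k`, the `(j,k)` entry of the randomized Hadamard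
transform of `z`, where `D j` records the diagonal entries of the diagonal matrix `D^j`. -/
def rht (ℓ m : ℕ) (D : Fin m → Fin (2 ^ ℓ) → ℝ) (z : EuclideanSpace ℝ (Fin (2 ^ ℓ)))
    (j : Fin m) (k : Fin (2 ^ ℓ)) : ℝ :=
  (Had ℓ).mulVec (fun i => D j i * z i) k

/-- The joint law of the diagonal entries of `D^1, …, D^m`: i.i.d. standard Gaussians. -/
def diagMeasure (ℓ m : ℕ) : Measure (Fin m → Fin (2 ^ ℓ) → ℝ) :=
  Measure.pi fun _ => Measure.pi fun _ => gaussianReal 0 1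

/-- The law of a vector of i.i.d. standard Gaussians. -/
abbrev gaussianPi (ι : Type*) [Fintype ι] : Measure (ι → ℝ) :=
  Measure.pi fun _ => gaussianReal 0 1

/-- Jensen's inequality for the exponential, with an extended-valued right-hand side. -/
lemma ofReal_exp_integral_le_lintegral {α : Type*} [MeasurableSpace α] {ν : Measure α}
    [IsProbabilityMeasure ν] {X : α → ℝ} (hX : Integrable X ν) :
    ENNReal.ofReal (Real.exp (∫ a, X a ∂ν)) ≤ ∫⁻ a, ENNReal.ofReal (Real.exp (X a)) ∂ν := by
  by_cases htop : ∫⁻ a, ENNReal.ofReal (Real.exp (X a)) ∂ν = ⊤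
  · simp [htop]
  have hmeas : AEStronglyMeasurable (fun a => Real.exp (X a)) ν :=
    Real.continuous_exp.comp_aestronglyMeasurable hX.1
  have hInt : Integrable (fun a => Real.exp (X a)) ν :=
    (lintegral_ofReal_ne_top_iff_integrable hmeas
      (Filter.Eventually.of_forall fun a => (Real.exp_pos _).le)).1 htop
  rw [← ofReal_integral_eq_lintegral_ofReal hInt
    (Filter.Eventually.of_forall fun a => (Real.exp_pos _).le)]
  exact ENNReal.ofReal_le_ofReal (convexOn_exp.map_integral_le Real.continuous_exp.continuousOn
    isClosed_univ (by simp) hX hInt)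

section LinearForms

variable {ι : Type*} [Fintype ι]

/-- A linear form in i.i.d. standard Gaussians is a centered Gaussian. -/
lemma gaussianPi_map_sum (c : ι → ℝ) :
    (gaussianPi ι).map (fun x => ∑ i, c i * x i) = gaussianReal 0 (∑ i, ‖c i‖₊ ^ 2) := by
  have hm : Measurable fun x : ι → ℝ => ∑ i, c i * x i := by fun_prop
  have : IsProbabilityMeasure ((gaussianPi ι).map (fun x => ∑ i, c i * x i)) :=
    Measure.isProbabilityMeasure_map hm.aemeasurable
  refine Measure.ext_of_charFun ?_
  ext t
  rw [charFun_gaussianReal, charFun_apply_real, integral_map hm.aemeasurable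
    (by fun_prop)]
  have h1 : ∀ x : ι → ℝ, Complex.exp (t * ((∑ i, c i * x i : ℝ) : ℂ) * Complex.I)
      = ∏ i, Complex.exp (((t * c i : ℝ) : ℂ) * (x i : ℂ) * Complex.I) := by
    intro x
    rw [← Complex.exp_sum]
    congr 1
    push_cast
    rw [Finset.mul_sum, Finset.sum_mul]
    exact Finset.sum_congr rfl fun i _ => by ring
  simp_rw [h1]
  rw [integral_fintype_prod_eq_prod (𝕜 := ℂ)
    (fun i (y : ℝ) => Complex.exp (((t * c i : ℝ) : ℂ) * (y : ℂ) * Complex.I))]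
  simp_rw [← charFun_apply_real, charFun_gaussianReal]
  rw [← Complex.exp_sum]
  congr 1
  have h2 : (((∑ i, ‖c i‖₊ ^ 2 : ℝ≥0) : ℝ) : ℂ) = ∑ i, (c i : ℂ) ^ 2 := by
    push_cast
    exact Finset.sum_congr rfl fun i _ => by
      rw [← Complex.ofReal_pow, ← Complex.ofReal_pow]; simp
  rw [h2]
  simp only [Complex.ofReal_zero, mul_zero, zero_mul, zero_sub, NNReal.coe_one, Complex.ofReal_one,
    one_mul]
  rw [Finset.sum_mul, Finset.sum_div, ← Finset.sum_neg_distrib]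
  exact Finset.sum_congr rfl fun i _ => by push_cast; ring

lemma lintegral_exp_gaussianPi (c : ι → ℝ) :
    ∫⁻ y, ENNReal.ofReal (Real.exp (∑ i, c i * y i)) ∂gaussianPi ι
      = ENNReal.ofReal (Real.exp ((∑ i, c i ^ 2) / 2)) := by
  have hm : Measurable fun x : ι → ℝ => ∑ i, c i * x i := by fun_prop
  have h1 := lintegral_map (μ := gaussianPi ι) (f := fun u : ℝ => ENNReal.ofReal (Real.exp u))
    (by fun_prop) hm
  rw [← h1, gaussianPi_map_sum]
  have hInt : Integrable (fun u : ℝ => Real.exp u) (gaussianReal 0 (∑ i, ‖c i‖₊ ^ 2)) := by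
    simpa using integrable_exp_mul_gaussianReal (μ := 0) (v := ∑ i, ‖c i‖₊ ^ 2) 1
  rw [← ofReal_integral_eq_lintegral_ofReal hInt
    (Filter.Eventually.of_forall fun a => (Real.exp_pos _).le)]
  have h2 := congrFun (mgf_id_gaussianReal (μ := 0) (v := ∑ i, ‖c i‖₊ ^ 2)) 1
  simp only [mgf, id, one_mul, mul_one, one_pow, zero_add] at h2
  rw [h2]
  simp

end LinearForms

section Interpolation

variable {ι : Type*} [Fintype ι]

/-- Rotating the coordinates in `V` of a pair of independent standard Gaussian vectors preserves
their law. -/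
lemma measurePreserving_rotation_on (V : Set ι) (θ : ℝ) :
    MeasurePreserving
      (fun p : (ι → ℝ) × (ι → ℝ) =>
        ((fun i => if i ∈ V then Real.cos θ * p.1 i + Real.sin θ * p.2 i else p.1 i,
          fun i => if i ∈ V then -Real.sin θ * p.1 i + Real.cos θ * p.2 i else p.2 i) :
          (ι → ℝ) × (ι → ℝ)))
      ((gaussianPi ι).prod (gaussianPi ι)) ((gaussianPi ι).prod (gaussianPi ι)) := by
  have hrot : MeasurePreserving (ContinuousLinearMap.rotation (E := ℝ) θ)
      ((gaussianReal 0 1).prod (gaussianReal 0 1)) ((gaussianReal 0 1).prod (gaussianReal 0 1)) := by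
    refine ⟨(ContinuousLinearMap.rotation (E := ℝ) θ).continuous.measurable, ?_⟩
    refine IsGaussian.map_rotation_eq_self_of_forall_strongDual_eq_zero (fun L => ?_) θ
    rw [integral_continuousLinearMap_gaussianReal]
    simp
  let r : ι → ℝ × ℝ → ℝ × ℝ := fun i =>
    if i ∈ V then ContinuousLinearMap.rotation (E := ℝ) θ else id
  have hr : ∀ i, MeasurePreserving (r i) ((gaussianReal 0 1).prod (gaussianReal 0 1))
      ((gaussianReal 0 1).prod (gaussianReal 0 1)) := by
    intro i
    by_cases hi : i ∈ V
    · simpa [r, hi] using hrot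
    · simpa [r, hi] using MeasurePreserving.id _
  have hpi := measurePreserving_pi (fun _ : ι => (gaussianReal 0 1).prod (gaussianReal 0 1))
    (fun _ : ι => (gaussianReal 0 1).prod (gaussianReal 0 1)) hr
  have he := measurePreserving_arrowProdEquivProdArrow ℝ ℝ ι (fun _ => gaussianReal 0 1)
    (fun _ => gaussianReal 0 1)
  have hcomp := (he.comp hpi).comp (MeasurePreserving.symm _ he)
  convert hcomp using 1
  ext p i
  · by_cases hi : i ∈ V <;>
      simp [r, hi, MeasurableEquiv.arrowProdEquivProdArrow, Equiv.arrowProdEquivProdArrow,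
        ContinuousLinearMap.rotation_apply]
  · by_cases hi : i ∈ V <;>
      simp [r, hi, MeasurableEquiv.arrowProdEquivProdArrow, Equiv.arrowProdEquivProdArrow,
        ContinuousLinearMap.rotation_apply]

/-- Jensen's inequality applied to the increment of a `C¹` function over the unit interval. -/
lemma ofReal_exp_sub_le_lintegral_deriv {h h' : ℝ → ℝ} (hh : ∀ t, HasDerivAt h (h' t) t)
    (hc : Continuous h') :
    ENNReal.ofReal (Real.exp (h 1 - h 0))
      ≤ ∫⁻ t in Set.Ioc (0 : ℝ) 1, ENNReal.ofReal (Real.exp (h' t)) := by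
  have hprob : IsProbabilityMeasure (volume.restrict (Set.Ioc (0 : ℝ) 1)) := ⟨by simp⟩
  rw [← intervalIntegral.integral_eq_sub_of_hasDerivAt (a := 0) (b := 1) (fun t _ => hh t)
    (hc.intervalIntegrable _ _), intervalIntegral.integral_of_le zero_le_one]
  exact ofReal_exp_integral_le_lintegral
    ((hc.integrableOn_Icc (a := 0) (b := 1)).mono_set Set.Ioc_subset_Icc_self)

/-- Gaussian concentration in the coordinates of `V`, conditionally on the other coordinates:
the exponential moment of `Ψ` recentered at its conditional mean is sub-Gaussian, with variance
proxy controlled by the partial gradient of `Ψ`. -/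
lemma lintegral_exp_sub_partial_mean_le {Ψ : (ι → ℝ) → ℝ} {G : (ι → ℝ) → ι → ℝ}
    (hG : Continuous G)
    (hΨ : ∀ x, HasFDerivAt Ψ
      (∑ i, G x i • ContinuousLinearMap.proj (R := ℝ) (φ := fun _ : ι => ℝ) i) x)
    (V : Set ι) {K : ℝ} (hK : ∀ x, ∑ i, (if i ∈ V then G x i else 0) ^ 2 ≤ K)
    (hInt : ∀ x, Integrable (fun y => Ψ (V.piecewise y x)) (gaussianPi ι)) (lam : ℝ) :
    ∫⁻ x, ENNReal.ofReal
        (Real.exp (lam * (Ψ x - ∫ y, Ψ (V.piecewise y x) ∂gaussianPi ι))) ∂gaussianPi ι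
      ≤ ENNReal.ofReal (Real.exp (lam ^ 2 * π ^ 2 * K / 8)) := by
  let path : ℝ → (ι → ℝ) × (ι → ℝ) → ι → ℝ := fun t p i =>
    if i ∈ V then Real.cos (π / 2 * t) * p.1 i + Real.sin (π / 2 * t) * p.2 i else p.1 i
  let vel : ℝ → (ι → ℝ) × (ι → ℝ) → ι → ℝ := fun t p i =>
    if i ∈ V then -Real.sin (π / 2 * t) * p.1 i + Real.cos (π / 2 * t) * p.2 i else p.2 i
  let c : (ι → ℝ) → ι → ℝ := fun x i => if i ∈ V then -lam * (π / 2) * G x i else 0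
  have hcont_path : Continuous fun q : ℝ × ((ι → ℝ) × (ι → ℝ)) => path q.1 q.2 := by
    refine continuous_pi fun i => ?_
    by_cases hi : i ∈ V
    · simp only [path, hi, if_true]; fun_prop
    · simp only [path, hi, if_false]; fun_prop
  have hcont_vel : Continuous fun q : ℝ × ((ι → ℝ) × (ι → ℝ)) => vel q.1 q.2 := by
    refine continuous_pi fun i => ?_
    by_cases hi : i ∈ V
    · simp only [vel, hi, if_true]; fun_prop
    · simp only [vel, hi, if_false]; fun_prop
  have hcont_c : Continuous c := by
    refine continuous_pi fun i => ?_
    by_cases hi : i ∈ V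
    · simp only [c, hi, if_true]; fun_prop
    · simp only [c, hi, if_false]; fun_prop
  have hcont_F : Continuous fun q : (ι → ℝ) × (ι → ℝ) => ∑ i, c q.1 i * q.2 i := by fun_prop
  obtain ⟨Φ, hΦ⟩ : ∃ Φ : ℝ → (ι → ℝ) × (ι → ℝ) → ℝ,
      ∀ t p, Φ t p = ∑ i, c (path t p) i * vel t p i := ⟨_, fun _ _ => rfl⟩
  have hcont_Φ : Continuous fun q : ℝ × ((ι → ℝ) × (ι → ℝ)) => Φ q.1 q.2 := by
    simp_rw [hΦ]
    fun_prop
  have hderiv : ∀ p t, HasDerivAt (fun t => -lam * Ψ (path t p))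
      (Φ t p) t := by
    intro p t
    rw [hΦ]
    have hp : HasDerivAt (fun t => path t p)
        (fun i => if i ∈ V then π / 2 * vel t p i else 0) t := by
      rw [hasDerivAt_pi]
      intro i
      by_cases hi : i ∈ V
      · simp only [path, vel, hi, if_true]
        have hlin : HasDerivAt (fun t : ℝ => π / 2 * t) (π / 2) t := by
          simpa using (hasDerivAt_id t).const_mul (π / 2)
        exact ((hlin.cos.mul_const (p.1 i)).fun_add (hlin.sin.mul_const (p.2 i))).congr_deriv
          (by ring)
      · simp only [path, hi, if_false]
        exact hasDerivAt_const _ _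
    refine (((hΨ (path t p)).comp_hasDerivAt t hp).const_mul (-lam)).congr_deriv ?_
    simp only [sum_apply, smul_apply, ContinuousLinearMap.proj_apply, smul_eq_mul, Finset.mul_sum]
    refine Finset.sum_congr rfl fun i _ => ?_
    by_cases hi : i ∈ V
    · simp only [c, hi, if_true]; ring
    · simp [c, hi]
  have hpath0 : ∀ p, path 0 p = p.1 := fun p => by ext i; simp [path]
  have hpath1 : ∀ p, path 1 p = V.piecewise p.2 p.1 := fun p => by
    ext i; by_cases hi : i ∈ V <;> simp [path, hi]
  have hbound : ∀ t : ℝ, ∫⁻ p, ENNReal.ofReal (Real.exp (Φ t p))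
      ∂((gaussianPi ι).prod (gaussianPi ι))
      ≤ ENNReal.ofReal (Real.exp (lam ^ 2 * π ^ 2 * K / 8)) := by
    intro t
    simp_rw [hΦ]
    have hmF : Measurable fun q : (ι → ℝ) × (ι → ℝ) =>
        ENNReal.ofReal (Real.exp (∑ i, c q.1 i * q.2 i)) :=
      ENNReal.measurable_ofReal.comp (Real.continuous_exp.comp hcont_F).measurable
    have hrot := (measurePreserving_rotation_on V (π / 2 * t)).lintegral_comp hmF
    refine (le_of_eq hrot).trans ?_
    rw [lintegral_prod _ hmF.aemeasurable]
    simp_rw [lintegral_exp_gaussianPi]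
    refine (lintegral_mono (g := fun _ => ENNReal.ofReal (Real.exp (lam ^ 2 * π ^ 2 * K / 8)))
      fun x => ENNReal.ofReal_le_ofReal (Real.exp_le_exp.2 ?_)).trans (by simp)
    have hc2 : ∑ i, c x i ^ 2 = lam ^ 2 * (π / 2) ^ 2 * ∑ i, (if i ∈ V then G x i else 0) ^ 2 := by
      rw [Finset.mul_sum]
      refine Finset.sum_congr rfl fun i _ => ?_
      by_cases hi : i ∈ V
      · simp only [c, hi, if_true]; ring
      · simp [c, hi]
    rw [hc2]
    have := mul_le_mul_of_nonneg_left (hK x) (by positivity : 0 ≤ lam ^ 2 * (π / 2) ^ 2)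
    linarith
  calc _ ≤ ∫⁻ x, ∫⁻ y, ENNReal.ofReal (Real.exp (lam * (Ψ x - Ψ (V.piecewise y x))))
        ∂gaussianPi ι ∂gaussianPi ι := by
        refine lintegral_mono fun x => ?_
        have h := ofReal_exp_integral_le_lintegral
          (((integrable_const (Ψ x)).sub (hInt x)).const_mul lam)
        simp only [Pi.sub_apply] at h
        rwa [integral_const_mul, integral_sub (integrable_const _) (hInt x), integral_const,
          probReal_univ, one_smul] at h
    _ ≤ ∫⁻ x, ∫⁻ y, (∫⁻ t in Set.Ioc (0 : ℝ) 1,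
          ENNReal.ofReal (Real.exp (Φ t (x, y))))
        ∂gaussianPi ι ∂gaussianPi ι := by
        refine lintegral_mono fun x => lintegral_mono fun y => ?_
        have hc : Continuous fun t => Φ t (x, y) :=
          hcont_Φ.comp (by fun_prop : Continuous fun t : ℝ => (t, (x, y)))
        have h := ofReal_exp_sub_le_lintegral_deriv (hderiv (x, y)) hc
        rw [hpath0, hpath1] at h
        refine le_trans (le_of_eq ?_) h
        congr 2
        ring
    _ = ∫⁻ t in Set.Ioc (0 : ℝ) 1, ∫⁻ p,
          ENNReal.ofReal (Real.exp (Φ t p))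
            ∂((gaussianPi ι).prod (gaussianPi ι)) := by
        have hm : Measurable fun q : ℝ × ((ι → ℝ) × (ι → ℝ)) =>
            ENNReal.ofReal (Real.exp (Φ q.1 q.2)) :=
          ENNReal.measurable_ofReal.comp (Real.continuous_exp.comp hcont_Φ).measurable
        refine Eq.symm ((lintegral_lintegral_swap hm.aemeasurable).trans ?_)
        exact lintegral_prod _ (Measurable.lintegral_prod_left' hm).aemeasurable
    _ ≤ ∫⁻ t in Set.Ioc (0 : ℝ) 1, ENNReal.ofReal (Real.exp (lam ^ 2 * π ^ 2 * K / 8)) :=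
        lintegral_mono fun t => hbound t
    _ = _ := by simp

end Interpolation

section Hadamard

lemma had_sq (ℓ : ℕ) (k i : Fin (2 ^ ℓ)) : Had ℓ k i ^ 2 = 1 := by
  induction ℓ with
  | zero =>
    have hk : k = i := Subsingleton.elim (α := Fin 1) k i
    have h1 : Had 0 i i = 1 := Matrix.one_apply_eq i
    rw [hk, h1, one_pow]
  | succ ℓ ih =>
    rw [Had, Matrix.reindex_apply, Matrix.submatrix_apply]
    generalize (finSumFinEquiv.trans (finCongr _)).symm k = a
    generalize (finSumFinEquiv.trans (finCongr _)).symm i = b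
    rcases a with a | a <;> rcases b with b | b <;> simp [ih]

lemma abs_had (ℓ : ℕ) (k i : Fin (2 ^ ℓ)) : |Had ℓ k i| = 1 := by
  rw [← sq_eq_sq₀ (abs_nonneg _) zero_le_one, sq_abs, had_sq, one_pow]

lemma had_mul_transpose (ℓ : ℕ) :
    Had ℓ * (Had ℓ).transpose = (2 ^ ℓ : ℝ) • (1 : Matrix (Fin (2 ^ ℓ)) (Fin (2 ^ ℓ)) ℝ) := by
  induction ℓ with
  | zero => simp [Had]
  | succ ℓ ih =>
    rw [Had, Matrix.transpose_reindex, Matrix.reindex_apply, Matrix.reindex_apply,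
      Matrix.submatrix_mul_equiv, Matrix.fromBlocks_transpose, Matrix.fromBlocks_multiply]
    simp only [Matrix.transpose_neg, Matrix.mul_neg, Matrix.neg_mul, neg_neg, add_neg_cancel, ih]
    have hblock : Matrix.fromBlocks
        ((2 : ℝ) ^ ℓ • (1 : Matrix (Fin (2 ^ ℓ)) (Fin (2 ^ ℓ)) ℝ) + (2 : ℝ) ^ ℓ • 1) 0 0
        ((2 : ℝ) ^ ℓ • (1 : Matrix (Fin (2 ^ ℓ)) (Fin (2 ^ ℓ)) ℝ) + (2 : ℝ) ^ ℓ • 1)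
        = (2 : ℝ) ^ (ℓ + 1) • (1 : Matrix (Fin (2 ^ ℓ) ⊕ Fin (2 ^ ℓ)) _ ℝ) := by
      rw [← Matrix.fromBlocks_one, Matrix.fromBlocks_smul, ← add_smul, pow_succ, mul_two]
      simp
    rw [hblock, Matrix.submatrix_smul, Pi.smul_apply, Pi.smul_apply, Matrix.submatrix_one_equiv]

lemma sum_sq_had_mul (ℓ : ℕ) (y : Fin (2 ^ ℓ) → ℝ) :
    ∑ i, (∑ k, y k * Had ℓ k i) ^ 2 = 2 ^ ℓ * ∑ k, y k ^ 2 := by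
  have h : Matrix.vecMul y (Had ℓ) ⬝ᵥ Matrix.vecMul y (Had ℓ) = 2 ^ ℓ * (y ⬝ᵥ y) := by
    rw [← Matrix.mulVec_transpose, Matrix.dotProduct_mulVec, Matrix.vecMul_transpose,
      Matrix.mulVec_mulVec, had_mul_transpose]
    simp [Matrix.smul_mulVec]
  simpa [dotProduct, Matrix.vecMul, pow_two] using h

/-- `(H_d D w)_k`, where `x` is the diagonal of `D`. -/
def hadBlock (ℓ : ℕ) (w x : Fin (2 ^ ℓ) → ℝ) (k : Fin (2 ^ ℓ)) : ℝ :=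
  (Had ℓ).mulVec (fun i => x i * w i) k

lemma hadBlock_eq_sum (ℓ : ℕ) (w x : Fin (2 ^ ℓ) → ℝ) (k : Fin (2 ^ ℓ)) :
    hadBlock ℓ w x k = ∑ i, (Had ℓ k i * w i) * x i := by
  simp only [hadBlock, Matrix.mulVec, dotProduct]
  exact Finset.sum_congr rfl fun i _ => by ring

lemma hadBlock_piecewise (ℓ : ℕ) (V : Set (Fin (2 ^ ℓ))) (w x y : Fin (2 ^ ℓ) → ℝ)
    (k : Fin (2 ^ ℓ)) :
    hadBlock ℓ w (V.piecewise y x) k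
      = hadBlock ℓ (Vᶜ.indicator w) x k + hadBlock ℓ (V.indicator w) y k := by
  simp only [hadBlock_eq_sum, ← Finset.sum_add_distrib]
  refine Finset.sum_congr rfl fun i _ => ?_
  by_cases hi : i ∈ V <;> simp [hi]

lemma gaussianPi_map_hadBlock (ℓ : ℕ) (w : Fin (2 ^ ℓ) → ℝ) (k : Fin (2 ^ ℓ)) :
    (gaussianPi (Fin (2 ^ ℓ))).map (fun x => hadBlock ℓ w x k)
      = gaussianReal 0 (∑ i, ‖w i‖₊ ^ 2) := by
  have h : ∀ i, ‖Had ℓ k i * w i‖₊ ^ 2 = ‖w i‖₊ ^ 2 := fun i => by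
    have h1 : ‖Had ℓ k i‖₊ = 1 := NNReal.eq (by simp [abs_had])
    rw [nnnorm_mul, h1, one_mul]
  simp_rw [hadBlock_eq_sum, gaussianPi_map_sum, h]

/-- The average of `g` over the entries of `H_d D w`, where `x` is the diagonal of `D`. -/
def hadAvg (ℓ : ℕ) (g : ℝ → ℝ) (w x : Fin (2 ^ ℓ) → ℝ) : ℝ :=
  (2 ^ ℓ : ℝ)⁻¹ * ∑ k, g (hadBlock ℓ w x k)

lemma continuous_hadBlock (ℓ : ℕ) (w : Fin (2 ^ ℓ) → ℝ) (k : Fin (2 ^ ℓ)) :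
    Continuous fun x => hadBlock ℓ w x k := by
  simp_rw [hadBlock_eq_sum]
  fun_prop

lemma continuous_hadAvg (ℓ : ℕ) {g : ℝ → ℝ} (hg : Continuous g) (w : Fin (2 ^ ℓ) → ℝ) :
    Continuous fun x => hadAvg ℓ g w x := by
  have := continuous_hadBlock ℓ w
  unfold hadAvg
  fun_prop

lemma abs_inv_mul_sum_le (ℓ : ℕ) {F : Fin (2 ^ ℓ) → ℝ} {r : ℝ} (hF : ∀ k, |F k| ≤ r) :
    |(2 ^ ℓ : ℝ)⁻¹ * ∑ k, F k| ≤ r := by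
  rw [abs_mul, abs_of_pos (by positivity : (0 : ℝ) < (2 ^ ℓ)⁻¹), inv_mul_le_iff₀ (by positivity)]
  calc |∑ k, F k| ≤ ∑ k, |F k| := Finset.abs_sum_le_sum_abs _ _
    _ ≤ ∑ _k : Fin (2 ^ ℓ), r := Finset.sum_le_sum fun k _ => hF k
    _ = 2 ^ ℓ * r := by simp

lemma abs_hadAvg_sub_le (ℓ : ℕ) {g₁ g₂ : ℝ → ℝ} {r : ℝ} (h : ∀ u, |g₁ u - g₂ u| ≤ r)
    (w x : Fin (2 ^ ℓ) → ℝ) : |hadAvg ℓ g₁ w x - hadAvg ℓ g₂ w x| ≤ r := by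
  rw [hadAvg, hadAvg, ← mul_sub, ← Finset.sum_sub_distrib]
  exact abs_inv_mul_sum_le ℓ fun k => h _

end Hadamard

section Smoothing

/-- The function `f` averaged against a centered Gaussian of variance `q`. -/
def gaussSmooth (q : ℝ≥0) (f : ℝ → ℝ) (x : ℝ) : ℝ := ∫ y, f (x + y) ∂gaussianReal 0 q

variable {f : ℝ → ℝ}

lemma abs_sub_le_of_lipschitz (hf : LipschitzWith 1 f) (x y : ℝ) : |f x - f y| ≤ |x - y| := by
  simpa [Real.dist_eq] using hf.dist_le_mul x y

lemma lipschitz_of_abs_sub_le (hf : ∀ x y, |f x - f y| ≤ |x - y|) : LipschitzWith 1 f :=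
  LipschitzWith.of_dist_le_mul fun x y => by simpa [Real.dist_eq] using hf x y

lemma integrable_of_lipschitz (hf : LipschitzWith 1 f) {μ : Measure ℝ} [IsFiniteMeasure μ]
    (hμ : Integrable id μ) (x : ℝ) : Integrable (fun y => f (x + y)) μ := by
  have hc := hf.continuous
  refine Integrable.mono' ((integrable_const |f x|).add hμ.abs) (by fun_prop)
    (Filter.Eventually.of_forall fun y => ?_)
  have h := abs_sub_le_of_lipschitz hf (x + y) x
  rw [add_sub_cancel_left] at h
  simp only [Real.norm_eq_abs, Pi.add_apply, id]
  linarith [abs_sub_abs_le_abs_sub (f (x + y)) (f x)]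

lemma integrable_id_gaussianReal (q : ℝ≥0) : Integrable id (gaussianReal 0 q) :=
  memLp_one_iff_integrable.1 (memLp_id_gaussianReal' 1 (by simp))

lemma integrable_gaussSmooth (hf : LipschitzWith 1 f) (q : ℝ≥0) (x : ℝ) :
    Integrable (fun y => f (x + y)) (gaussianReal 0 q) :=
  integrable_of_lipschitz hf (integrable_id_gaussianReal q) x

lemma lipschitz_gaussSmooth (hf : LipschitzWith 1 f) (q : ℝ≥0) :
    LipschitzWith 1 (gaussSmooth q f) := by
  refine lipschitz_of_abs_sub_le fun x y => ?_
  rw [gaussSmooth, gaussSmooth,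
    ← integral_sub (integrable_gaussSmooth hf q x) (integrable_gaussSmooth hf q y)]
  rw [← Real.norm_eq_abs]
  refine (norm_integral_le_of_norm_le_const (C := |x - y|)
    (Filter.Eventually.of_forall fun u => ?_)).trans (by simp)
  simpa using abs_sub_le_of_lipschitz hf (x + u) (y + u)

lemma gaussSmooth_zero (f : ℝ → ℝ) : gaussSmooth 0 f = f := by
  ext x
  simp [gaussSmooth]

lemma gaussSmooth_gaussSmooth (hf : LipschitzWith 1 f) (q r : ℝ≥0) :
    gaussSmooth q (gaussSmooth r f) = gaussSmooth (q + r) f := by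
  ext x
  have h := gaussianReal_conv_gaussianReal (m₁ := 0) (m₂ := 0) (v₁ := q) (v₂ := r)
  rw [add_zero] at h
  have hInt := integrable_gaussSmooth hf (q + r) x
  simp only [gaussSmooth]
  rw [← h] at hInt ⊢
  rw [integral_conv hInt]
  simp_rw [add_assoc]

lemma abs_gaussSmooth_sub_le {g₁ g₂ : ℝ → ℝ} (h₁ : LipschitzWith 1 g₁) (h₂ : LipschitzWith 1 g₂)
    {r : ℝ} (h : ∀ u, |g₁ u - g₂ u| ≤ r) (q : ℝ≥0) (x : ℝ) :
    |gaussSmooth q g₁ x - gaussSmooth q g₂ x| ≤ r := by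
  rw [gaussSmooth, gaussSmooth,
    ← integral_sub (integrable_gaussSmooth h₁ q x) (integrable_gaussSmooth h₂ q x)]
  rw [← Real.norm_eq_abs]
  exact (norm_integral_le_of_norm_le_const (C := r)
    (Filter.Eventually.of_forall fun u => h _)).trans (by simp)

lemma integral_abs_gaussianReal_le : ∫ y, |y| ∂gaussianReal 0 1 ≤ 1 := by
  have hv : Var[fun y : ℝ => y; gaussianReal 0 1] = 1 := by simp
  have hL : MemLp (fun y : ℝ => y) 2 (gaussianReal 0 1) := memLp_id_gaussianReal' 2 (by simp)
  rw [variance_eq_sub hL] at hv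
  have hsq : ∫ y : ℝ, y ^ 2 ∂gaussianReal 0 1 = 1 := by simpa using hv
  have hi2 : Integrable (fun y : ℝ => (1 + y ^ 2) / 2) (gaussianReal 0 1) :=
    ((integrable_const 1).add hL.integrable_sq).div_const 2
  calc ∫ y, |y| ∂gaussianReal 0 1 ≤ ∫ y : ℝ, (1 + y ^ 2) / 2 ∂gaussianReal 0 1 :=
        integral_mono (integrable_id_gaussianReal 1).abs hi2 fun y => by
          simp only
          nlinarith [sq_nonneg (|y| - 1), sq_abs y]
    _ = 1 := by
        rw [integral_div, integral_add (integrable_const 1) hL.integrable_sq, hsq]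
        norm_num

lemma gaussSmooth_sq (hf : LipschitzWith 1 f) (σ : ℝ≥0) :
    gaussSmooth (σ ^ 2) f 0 = ∫ y, f (σ * y) ∂gaussianReal 0 1 := by
  have hc := hf.continuous
  have h := gaussianReal_map_const_mul (μ := 0) (v := 1) (σ : ℝ)
  have h2 : (NNReal.mk ((σ : ℝ) ^ 2) (sq_nonneg _)) * 1 = σ ^ 2 := by
    ext; simp
  rw [h2, mul_zero] at h
  simp only [gaussSmooth, zero_add]
  rw [← h, integral_map (by fun_prop) (by fun_prop)]

lemma abs_gaussSmooth_sq_sub_le (hf : LipschitzWith 1 f) (σ τ : ℝ≥0) :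
    |gaussSmooth (σ ^ 2) f 0 - gaussSmooth (τ ^ 2) f 0| ≤ |(σ : ℝ) - τ| := by
  have hc := hf.continuous
  have hInt : ∀ σ : ℝ≥0, Integrable (fun y : ℝ => f (σ * y)) (gaussianReal 0 1) := by
    intro σ
    refine Integrable.mono' ((integrable_const |f 0|).add
      ((integrable_id_gaussianReal 1).abs.const_mul (σ : ℝ))) (by fun_prop)
      (Filter.Eventually.of_forall fun y => ?_)
    have h := abs_sub_le_of_lipschitz hf (σ * y) 0
    rw [sub_zero, abs_mul, abs_of_nonneg σ.coe_nonneg] at h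
    simp only [Real.norm_eq_abs, Pi.add_apply, id]
    linarith [abs_sub_abs_le_abs_sub (f (σ * y)) (f 0)]
  rw [gaussSmooth_sq hf, gaussSmooth_sq hf, ← integral_sub (hInt σ) (hInt τ)]
  calc |∫ y : ℝ, (f (σ * y) - f (τ * y)) ∂gaussianReal 0 1|
      ≤ ∫ y : ℝ, |(σ : ℝ) - τ| * |y| ∂gaussianReal 0 1 := by
        rw [← Real.norm_eq_abs]
        refine norm_integral_le_of_norm_le ((integrable_id_gaussianReal 1).abs.const_mul _)
          (Filter.Eventually.of_forall fun y => ?_)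
        rw [← abs_mul, sub_mul]
        exact abs_sub_le_of_lipschitz hf _ _
    _ ≤ |(σ : ℝ) - τ| := by
        rw [integral_const_mul]
        exact mul_le_of_le_one_right (abs_nonneg _) integral_abs_gaussianReal_le

/-- A `1`-Lipschitz function is uniformly close to a `1`-Lipschitz function with continuous
derivative. -/
lemma exists_smooth_approx (hf : LipschitzWith 1 f) {r : ℝ} (hr : 0 < r) :
    ∃ g g' : ℝ → ℝ, LipschitzWith 1 g ∧ (∀ x, HasDerivAt g (g' x) x) ∧ Continuous g' ∧
      (∀ x, |g' x| ≤ 1) ∧ ∀ x, |f x - g x| ≤ r := by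
  have hc := hf.continuous
  have hii : ∀ a b, IntervalIntegrable f volume a b := fun a b => hc.intervalIntegrable a b
  have hd : ∀ x, HasDerivAt (fun x => r⁻¹ * ∫ u in x..(x + r), f u)
      (r⁻¹ * (f (x + r) - f x)) x := by
    intro x
    have h0 : ∀ x, HasDerivAt (fun x => ∫ u in (0 : ℝ)..x, f u) (f x) x := fun x =>
      intervalIntegral.integral_hasDerivAt_right (hii _ _)
        hc.aestronglyMeasurable.stronglyMeasurableAtFilter hc.continuousAt
    have h1 : HasDerivAt (fun x => ∫ u in (0 : ℝ)..(x + r), f u) (f (x + r)) x :=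
      (h0 (x + r)).comp_add_const x r
    refine ((h1.fun_sub (h0 x)).const_mul r⁻¹).congr_of_eventuallyEq
      (Filter.Eventually.of_forall fun y => ?_)
    simp only
    rw [intervalIntegral.integral_interval_sub_left (hii _ _) (hii _ _)]
  have hb : ∀ x, |r⁻¹ * (f (x + r) - f x)| ≤ 1 := by
    intro x
    rw [abs_mul, abs_of_pos (inv_pos.2 hr), inv_mul_le_iff₀ hr, mul_one]
    simpa [abs_of_pos hr] using abs_sub_le_of_lipschitz hf (x + r) x
  refine ⟨_, _, ?_, hd, by fun_prop, hb, fun x => ?_⟩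
  · refine lipschitzWith_of_nnnorm_deriv_le (fun x => (hd x).differentiableAt) fun x => ?_
    rw [(hd x).deriv]
    exact hb x
  · have h1 : f x - r⁻¹ * ∫ u in x..(x + r), f u = r⁻¹ * ∫ u in x..(x + r), (f x - f u) := by
      rw [intervalIntegral.integral_sub (by simp) (hii _ _), intervalIntegral.integral_const]
      simp only [add_sub_cancel_left, smul_eq_mul]
      field_simp
    rw [h1, abs_mul, abs_of_pos (inv_pos.2 hr), inv_mul_le_iff₀ hr]
    have h2 := intervalIntegral.norm_integral_le_of_norm_le_const (a := x) (b := x + r)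
      (f := fun u => f x - f u) (C := r) (fun u hu => by
        rw [Set.uIoc_of_le (by linarith)] at hu
        refine (abs_sub_le_of_lipschitz hf x u).trans ?_
        rw [abs_le]
        constructor <;> linarith [hu.1, hu.2])
    simpa [abs_of_pos hr] using h2

end Smoothing

section Concentration

variable {ℓ : ℕ} {g : ℝ → ℝ}

lemma integrable_comp_hadBlock_piecewise (hg : LipschitzWith 1 g) (w x : Fin (2 ^ ℓ) → ℝ)
    (V : Set (Fin (2 ^ ℓ))) (k : Fin (2 ^ ℓ)) :
    Integrable (fun y => g (hadBlock ℓ w (V.piecewise y x) k)) (gaussianPi (Fin (2 ^ ℓ))) := by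
  have hm : Measurable fun y => hadBlock ℓ (V.indicator w) y k :=
    (continuous_hadBlock ℓ _ k).measurable
  simp_rw [hadBlock_piecewise]
  have h := integrable_gaussSmooth hg (∑ i, ‖V.indicator w i‖₊ ^ 2)
    (hadBlock ℓ (Vᶜ.indicator w) x k)
  rw [← gaussianPi_map_hadBlock ℓ (V.indicator w) k] at h
  exact h.comp_measurable hm

lemma integral_hadAvg_piecewise (hg : LipschitzWith 1 g) (w x : Fin (2 ^ ℓ) → ℝ)
    (V : Set (Fin (2 ^ ℓ))) :
    ∫ y, hadAvg ℓ g w (V.piecewise y x) ∂gaussianPi (Fin (2 ^ ℓ))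
      = hadAvg ℓ (gaussSmooth (∑ i, ‖V.indicator w i‖₊ ^ 2) g) (Vᶜ.indicator w) x := by
  have hc := hg.continuous
  simp only [hadAvg]
  rw [integral_const_mul, integral_finsetSum _ fun k _ =>
    integrable_comp_hadBlock_piecewise hg w x V k]
  congr 1
  refine Finset.sum_congr rfl fun k _ => ?_
  have hm : Measurable fun y => hadBlock ℓ (V.indicator w) y k :=
    (continuous_hadBlock ℓ _ k).measurable
  simp_rw [hadBlock_piecewise]
  rw [gaussSmooth, ← gaussianPi_map_hadBlock ℓ (V.indicator w) k, integral_map hm.aemeasurable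
    (by fun_prop)]

lemma lintegral_exp_hadAvg_le_of_deriv (hg : LipschitzWith 1 g) {g' : ℝ → ℝ}
    (hd : ∀ x, HasDerivAt g (g' x) x) (hc : Continuous g') (hb : ∀ x, |g' x| ≤ 1)
    (w : Fin (2 ^ ℓ) → ℝ) (V : Set (Fin (2 ^ ℓ))) {K : ℝ} (hK : ∀ i ∈ V, w i ^ 2 ≤ K)
    (hK0 : 0 ≤ K) (lam : ℝ) :
    ∫⁻ x, ENNReal.ofReal (Real.exp (lam * (hadAvg ℓ g w x -
        hadAvg ℓ (gaussSmooth (∑ i, ‖V.indicator w i‖₊ ^ 2) g) (Vᶜ.indicator w) x)))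
        ∂gaussianPi (Fin (2 ^ ℓ))
      ≤ ENNReal.ofReal (Real.exp (lam ^ 2 * π ^ 2 * K / 8)) := by
  simp_rw [← integral_hadAvg_piecewise hg]
  refine lintegral_exp_sub_partial_mean_le
    (G := fun x i => (2 ^ ℓ : ℝ)⁻¹ * ∑ k, g' (hadBlock ℓ w x k) * (Had ℓ k i * w i))
    ?_ (fun x => ?_) V (fun x => ?_) (fun x => ?_) lam
  · have := continuous_hadBlock ℓ w
    fun_prop
  · have hL : ∀ k, HasFDerivAt (fun x => hadBlock ℓ w x k)
        (∑ i, (Had ℓ k i * w i) •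
          ContinuousLinearMap.proj (R := ℝ) (φ := fun _ : Fin (2 ^ ℓ) => ℝ) i) x := by
      intro k
      simp_rw [hadBlock_eq_sum]
      exact HasFDerivAt.fun_sum fun i _ => (hasFDerivAt_apply i x).const_mul _
    have h := (HasFDerivAt.fun_sum (u := Finset.univ) fun k _ =>
      (hd (hadBlock ℓ w x k)).comp_hasFDerivAt x (hL k)).const_mul (2 ^ ℓ : ℝ)⁻¹
    refine h.congr_fderiv ?_
    ext v
    simp only [sum_apply, smul_apply, ContinuousLinearMap.proj_apply, smul_eq_mul, Finset.mul_sum,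
      Finset.sum_mul]
    rw [Finset.sum_comm]
    exact Finset.sum_congr rfl fun i _ => Finset.sum_congr rfl fun k _ => by ring
  · have h1 : ∀ i, (if i ∈ V then
        (2 ^ ℓ : ℝ)⁻¹ * ∑ k, g' (hadBlock ℓ w x k) * (Had ℓ k i * w i) else 0) ^ 2
        ≤ K * ((2 ^ ℓ : ℝ)⁻¹ ^ 2 * (∑ k, g' (hadBlock ℓ w x k) * Had ℓ k i) ^ 2) := by
      intro i
      by_cases hi : i ∈ V
      · simp only [hi, if_true]
        have h2 : ∑ k, g' (hadBlock ℓ w x k) * (Had ℓ k i * w i)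
            = w i * ∑ k, g' (hadBlock ℓ w x k) * Had ℓ k i := by
          rw [Finset.mul_sum]
          exact Finset.sum_congr rfl fun k _ => by ring
        rw [h2, mul_left_comm, mul_pow, mul_pow]
        exact mul_le_mul_of_nonneg_right (hK i hi) (by positivity)
      · simp only [hi, if_false]
        rw [zero_pow two_ne_zero]
        positivity
    refine (Finset.sum_le_sum fun i _ => h1 i).trans ?_
    rw [← Finset.mul_sum, ← Finset.mul_sum, sum_sq_had_mul]
    refine mul_le_of_le_one_right hK0 ?_
    have h3 : ∑ k, g' (hadBlock ℓ w x k) ^ 2 ≤ 2 ^ ℓ := by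
      calc ∑ k, g' (hadBlock ℓ w x k) ^ 2 ≤ ∑ _k : Fin (2 ^ ℓ), (1 : ℝ) :=
            Finset.sum_le_sum fun k _ => (sq_le_one_iff_abs_le_one _).2 (hb _)
        _ = 2 ^ ℓ := by simp
    calc (2 ^ ℓ : ℝ)⁻¹ ^ 2 * (2 ^ ℓ * ∑ k, g' (hadBlock ℓ w x k) ^ 2)
        ≤ (2 ^ ℓ : ℝ)⁻¹ ^ 2 * (2 ^ ℓ * 2 ^ ℓ) := by gcongr
      _ = 1 := by field_simp
  · exact (integrable_finsetSum _ fun k _ =>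
      integrable_comp_hadBlock_piecewise hg w x V k).const_mul _

lemma lintegral_exp_hadAvg_le (hg : LipschitzWith 1 g)
    (w : Fin (2 ^ ℓ) → ℝ) (V : Set (Fin (2 ^ ℓ))) {K : ℝ} (hK : ∀ i ∈ V, w i ^ 2 ≤ K)
    (hK0 : 0 ≤ K) (lam : ℝ) :
    ∫⁻ x, ENNReal.ofReal (Real.exp (lam * (hadAvg ℓ g w x -
        hadAvg ℓ (gaussSmooth (∑ i, ‖V.indicator w i‖₊ ^ 2) g) (Vᶜ.indicator w) x)))
        ∂gaussianPi (Fin (2 ^ ℓ))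
      ≤ ENNReal.ofReal (Real.exp (lam ^ 2 * π ^ 2 * K / 8)) := by
  set q : ℝ≥0 := ∑ i, ‖V.indicator w i‖₊ ^ 2
  have hr : ∀ r : ℝ, 0 < r → ∫⁻ x, ENNReal.ofReal (Real.exp (lam * (hadAvg ℓ g w x -
        hadAvg ℓ (gaussSmooth q g) (Vᶜ.indicator w) x))) ∂gaussianPi (Fin (2 ^ ℓ))
      ≤ ENNReal.ofReal (Real.exp (|lam| * (2 * r))) *
        ENNReal.ofReal (Real.exp (lam ^ 2 * π ^ 2 * K / 8)) := by
    intro r hr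
    obtain ⟨h, h', hh, hd, hc, hb, hclose⟩ := exists_smooth_approx hg hr
    refine le_trans ?_ (mul_le_mul_right
      (lintegral_exp_hadAvg_le_of_deriv hh hd hc hb w V hK hK0 lam) _)
    rw [← lintegral_const_mul' _ _ ENNReal.ofReal_ne_top]
    refine lintegral_mono fun x => ?_
    simp only
    rw [← ENNReal.ofReal_mul (Real.exp_pos _).le, ← Real.exp_add]
    refine ENNReal.ofReal_le_ofReal (Real.exp_le_exp.2 ?_)
    have e1 := abs_le.1 (abs_hadAvg_sub_le ℓ hclose w x)
    have e2 := abs_le.1 (abs_hadAvg_sub_le ℓ (abs_gaussSmooth_sub_le hg hh hclose q)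
      (Vᶜ.indicator w) x)
    have e3 : lam * ((hadAvg ℓ g w x - hadAvg ℓ (gaussSmooth q g) (Vᶜ.indicator w) x) -
        (hadAvg ℓ h w x - hadAvg ℓ (gaussSmooth q h) (Vᶜ.indicator w) x)) ≤ |lam| * (2 * r) := by
      refine (le_abs_self _).trans ?_
      rw [abs_mul]
      refine mul_le_mul_of_nonneg_left ?_ (abs_nonneg _)
      rw [abs_le]
      constructor <;> linarith [e1.1, e1.2, e2.1, e2.2]
    linarith
  have hlim : Filter.Tendsto (fun r : ℝ => ENNReal.ofReal (Real.exp (|lam| * (2 * r))) *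
      ENNReal.ofReal (Real.exp (lam ^ 2 * π ^ 2 * K / 8))) (nhdsWithin 0 (Set.Ioi 0))
      (nhds (ENNReal.ofReal (Real.exp (|lam| * (2 * 0))) *
        ENNReal.ofReal (Real.exp (lam ^ 2 * π ^ 2 * K / 8)))) := by
    refine ENNReal.Tendsto.mul_const ?_ (Or.inr ENNReal.ofReal_ne_top)
    refine Filter.Tendsto.mono_left ?_ nhdsWithin_le_nhds
    exact (ENNReal.continuous_ofReal.comp
      (by fun_prop : Continuous fun r : ℝ => Real.exp (|lam| * (2 * r)))).tendsto 0
  refine (ge_of_tendsto hlim ?_).trans (by simp)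
  filter_upwards [self_mem_nhdsWithin] with r hr0 using hr r hr0

/-- The average of `g` over all entries of the randomized Hadamard transform of `w`. -/
def rhtAvg (ℓ m : ℕ) (g : ℝ → ℝ) (w : Fin (2 ^ ℓ) → ℝ) (D : Fin m → Fin (2 ^ ℓ) → ℝ) : ℝ :=
  (m : ℝ)⁻¹ * ∑ j, hadAvg ℓ g w (D j)

lemma lintegral_pi_prod {κ E : Type*} [Fintype κ] [MeasurableSpace E] (μ : Measure E)
    [IsProbabilityMeasure μ] {F : E → ℝ≥0∞} (hF : Measurable F) :
    ∫⁻ x : κ → E, ∏ j, F (x j) ∂Measure.pi (fun _ => μ) = (∫⁻ x, F x ∂μ) ^ Fintype.card κ := by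
  have hind := iIndepFun_pi (μ := fun _ : κ => μ) (X := fun _ => F) fun _ => hF.aemeasurable
  rw [lintegral_prod_eq_prod_lintegral_of_indepFun Finset.univ (fun j (x : κ → E) => F (x j)) hind
    (fun j => hF.comp (measurable_pi_apply j))]
  have h : ∀ j : κ, ∫⁻ x : κ → E, F (x j) ∂Measure.pi (fun _ => μ) = ∫⁻ x, F x ∂μ := fun j =>
    (measurePreserving_eval (fun _ : κ => μ) j).lintegral_comp hF
  simp [h]

variable {m : ℕ}

lemma diagMeasure_signed_tail_le (hm : 0 < m) (hg : LipschitzWith 1 g) (w : Fin (2 ^ ℓ) → ℝ)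
    (V : Set (Fin (2 ^ ℓ))) {K a σ : ℝ} (hK : ∀ i ∈ V, w i ^ 2 ≤ K) (hK0 : 0 < K) (ha : 0 ≤ a)
    (hσ : σ ^ 2 = 1) :
    diagMeasure ℓ m {D | a ≤ σ * (rhtAvg ℓ m g w D -
        rhtAvg ℓ m (gaussSmooth (∑ i, ‖V.indicator w i‖₊ ^ 2) g) (Vᶜ.indicator w) D)}
      ≤ ENNReal.ofReal (Real.exp (-(m * a ^ 2 / (5 * K)))) := by
  set q : ℝ≥0 := ∑ i, ‖V.indicator w i‖₊ ^ 2 with hq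
  set X : (Fin (2 ^ ℓ) → ℝ) → ℝ := fun x => hadAvg ℓ g w x -
    hadAvg ℓ (gaussSmooth q g) (Vᶜ.indicator w) x with hX
  set lam : ℝ := 2 * a / (5 * K) with hlam
  have hlam0 : 0 ≤ lam := by positivity
  have hm' : (0 : ℝ) < m := by exact_mod_cast hm
  have hXc : Continuous X :=
    (continuous_hadAvg ℓ hg.continuous w).sub
      (continuous_hadAvg ℓ (lipschitz_gaussSmooth hg q).continuous _)
  set F : (Fin (2 ^ ℓ) → ℝ) → ℝ≥0∞ := fun x =>
    ENNReal.ofReal (Real.exp (σ * lam * X x)) with hF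
  have hFm : Measurable F :=
    ENNReal.measurable_ofReal.comp
      (Real.continuous_exp.comp (continuous_const.mul hXc)).measurable
  have hmoment : ∫⁻ D, ∏ j, F (D j) ∂diagMeasure ℓ m
      ≤ ENNReal.ofReal (Real.exp (m * (lam ^ 2 * π ^ 2 * K / 8))) := by
    have h := lintegral_exp_hadAvg_le hg w V hK hK0.le (σ * lam)
    rw [mul_pow, hσ, one_mul] at h
    rw [diagMeasure, lintegral_pi_prod _ hFm, Fintype.card_fin]
    refine (pow_le_pow_left' h m).trans ?_
    rw [← ENNReal.ofReal_pow (Real.exp_pos _).le, ← Real.exp_nat_mul]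
  have hsub : {D | a ≤ σ * (rhtAvg ℓ m g w D -
        rhtAvg ℓ m (gaussSmooth q g) (Vᶜ.indicator w) D)}
      ⊆ {D | ENNReal.ofReal (Real.exp (lam * (m * a))) ≤ ∏ j, F (D j)} := by
    intro D hD
    simp only [Set.mem_ofPred_eq, hF] at hD ⊢
    rw [← ENNReal.ofReal_prod_of_nonneg fun j _ => (Real.exp_pos _).le, ← Real.exp_sum]
    refine ENNReal.ofReal_le_ofReal (Real.exp_le_exp.2 ?_)
    have hsum : rhtAvg ℓ m g w D - rhtAvg ℓ m (gaussSmooth q g) (Vᶜ.indicator w) D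
        = (m : ℝ)⁻¹ * ∑ j, X (D j) := by
      simp only [rhtAvg, hX, Finset.sum_sub_distrib, mul_sub]
    rw [hsum, mul_left_comm, le_inv_mul_iff₀ hm'] at hD
    rw [← Finset.mul_sum, mul_comm σ lam, mul_assoc]
    exact mul_le_mul_of_nonneg_left hD hlam0
  have hmarkov := (mul_meas_ge_le_lintegral (μ := diagMeasure ℓ m)
    (f := fun D => ∏ j, F (D j))
    (Finset.measurable_prod _ fun j _ => hFm.comp (measurable_pi_apply j))
    (ENNReal.ofReal (Real.exp (lam * (m * a))))).trans hmoment
  refine (measure_mono hsub).trans ?_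
  have hpos : ENNReal.ofReal (Real.exp (lam * (m * a))) ≠ 0 := by
    simpa using Real.exp_pos _
  rw [mul_comm, ← ENNReal.le_div_iff_mul_le (Or.inl hpos) (Or.inl ENNReal.ofReal_ne_top),
    ← ENNReal.ofReal_div_of_pos (Real.exp_pos _), ← Real.exp_sub] at hmarkov
  refine hmarkov.trans (ENNReal.ofReal_le_ofReal (Real.exp_le_exp.2 ?_))
  have hpi : π ^ 2 ≤ 10 := by nlinarith [Real.pi_lt_d2, Real.pi_pos]
  have h1 : lam ^ 2 * π ^ 2 * K / 8 ≤ lam ^ 2 * 10 * K / 8 := by gcongr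
  have h2 : lam ^ 2 * 10 * K / 8 - lam * a = -(a ^ 2 / (5 * K)) := by
    rw [hlam]
    field_simp
    ring
  calc m * (lam ^ 2 * π ^ 2 * K / 8) - lam * (m * a)
      ≤ m * (lam ^ 2 * 10 * K / 8 - lam * a) := by nlinarith
    _ = -(m * a ^ 2 / (5 * K)) := by rw [h2]; ring

lemma diagMeasure_tail_le (hm : 0 < m) (hg : LipschitzWith 1 g) (w : Fin (2 ^ ℓ) → ℝ)
    (V : Set (Fin (2 ^ ℓ))) {K a : ℝ} (hK : ∀ i ∈ V, w i ^ 2 ≤ K) (hK0 : 0 < K) (ha : 0 ≤ a) :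
    diagMeasure ℓ m {D | a < |rhtAvg ℓ m g w D -
        rhtAvg ℓ m (gaussSmooth (∑ i, ‖V.indicator w i‖₊ ^ 2) g) (Vᶜ.indicator w) D|}
      ≤ 2 * ENNReal.ofReal (Real.exp (-(m * a ^ 2 / (5 * K)))) := by
  rw [two_mul]
  refine (measure_mono (fun D hD => ?_)).trans ((measure_union_le _ _).trans (add_le_add
    (diagMeasure_signed_tail_le hm hg w V hK hK0 ha (σ := 1) (by norm_num))
    (diagMeasure_signed_tail_le hm hg w V hK hK0 ha (σ := -1) (by norm_num))))
  rcases lt_abs.1 (Set.mem_ofPred_eq ▸ hD) with h | h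
  · left
    simpa using h.le
  · right
    simpa using h.le

end Concentration

section Net

/-- Sparse bounded integer vectors are contained in a small finite set. -/
lemma exists_finset_sparse (ι : Type*) [Fintype ι] [Nonempty ι] (N K : ℕ) :
    ∃ W : Finset (ι → ℤ), W.card ≤ (Fintype.card ι * (2 * N + 1)) ^ K ∧
      ∀ w : ι → ℤ, (∀ i, |w i| ≤ N) → (Finset.univ.filter fun i => w i ≠ 0).card ≤ K → w ∈ W := by
  let decode : (Fin K → ι × Finset.Icc (-(N : ℤ)) N) → ι → ℤ := fun p i =>
    if h : ∃ k, (p k).1 = i then ((p h.choose).2 : ℤ) else 0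
  refine ⟨Finset.univ.image decode, Finset.card_image_le.trans (le_of_eq ?_), fun w hw hcard => ?_⟩
  · have h : ((N : ℤ) + 1 + (N : ℤ)).toNat = 2 * N + 1 := by omega
    simp [h]
  · let S := Finset.univ.filter fun i => w i ≠ 0
    obtain ⟨emb⟩ : Nonempty (S ↪ Fin K) :=
      Function.Embedding.nonempty_of_card_le
        (by rw [Fintype.card_coe, Fintype.card_fin]; exact hcard)
    obtain ⟨i₀⟩ := ‹Nonempty ι›
    let e : Fin K → ι := Function.extend emb Subtype.val fun _ => i₀
    have hmem : ∀ i, w i ∈ Finset.Icc (-(N : ℤ)) N := fun i =>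
      Finset.mem_Icc.2 (abs_le.1 (hw i))
    refine Finset.mem_image.2 ⟨fun k => (e k, ⟨w (e k), hmem _⟩), Finset.mem_univ _, ?_⟩
    ext i
    by_cases h : ∃ k, e k = i
    · have hspec := h.choose_spec
      simp only [decode, h, dif_pos]
      rw [hspec]
    · simp only [decode, h, dif_neg, not_false_iff]
      by_contra hne
      have hi : i ∈ S := by simpa [S] using Ne.symm hne
      exact h ⟨emb ⟨i, hi⟩, emb.injective.extend_apply Subtype.val _ ⟨i, hi⟩⟩

lemma nnnorm_indicator_sq_add {ι : Type*} {A B C : Set ι} {z : ι → ℝ} {i : ι}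
    (hA : i ∈ C ↔ i ∈ A ∨ i ∈ B) (hdisj : ¬(i ∈ A ∧ i ∈ B)) :
    ‖A.indicator z i‖₊ ^ 2 + ‖B.indicator z i‖₊ ^ 2 = ‖C.indicator z i‖₊ ^ 2 := by
  by_cases h1 : i ∈ A <;> by_cases h2 : i ∈ B <;> simp_all

variable {ℓ m : ℕ} {f : ℝ → ℝ}

lemma rhtAvg_zero (hm : 0 < m) (g : ℝ → ℝ) (D : Fin m → Fin (2 ^ ℓ) → ℝ) :
    rhtAvg ℓ m g 0 D = g 0 := by
  have hm_ne : (m : ℝ) ≠ 0 := by exact_mod_cast hm.ne'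
  have hb : ∀ x k, hadBlock ℓ 0 x k = 0 := fun x k => by simp [hadBlock_eq_sum]
  simp [rhtAvg, hadAvg, hb, hm_ne]

/-- Telescoping over the magnitudes of the entries: if replacing the smallest entries of every
sparse integer vector by Gaussian smoothing is accurate up to `b`, then the empirical average is
accurate up to `(ℓ + 1) * b`. -/
lemma abs_rhtAvg_sub_gaussSmooth_le (hm : 0 < m) (hf : LipschitzWith 1 f) {N : ℕ} (hN : 0 < N)
    {b : ℝ} {D : Fin m → Fin (2 ^ ℓ) → ℝ}
    (H : ∀ s ≤ ℓ, ∀ w : Fin (2 ^ ℓ) → ℤ, (∀ i, |w i| ≤ N) →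
      (Finset.univ.filter fun i => w i ≠ 0).card ≤ 2 ^ (s + 1) → ∀ n ≤ N ^ 2,
      |rhtAvg ℓ m (gaussSmooth (n / (N : ℝ≥0) ^ 2) f) (fun i => (w i : ℝ) / N) D -
        rhtAvg ℓ m (gaussSmooth (∑ i, ‖{i | 2 ^ s * w i ^ 2 ≤ (N : ℤ) ^ 2}.indicator
          (fun i => (w i : ℝ) / N) i‖₊ ^ 2) (gaussSmooth (n / (N : ℝ≥0) ^ 2) f))
          ({i | 2 ^ s * w i ^ 2 ≤ (N : ℤ) ^ 2}ᶜ.indicator fun i => (w i : ℝ) / N) D| ≤ b)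
    (a : Fin (2 ^ ℓ) → ℤ) (ha : ∑ i, a i ^ 2 ≤ (N : ℤ) ^ 2) :
    |rhtAvg ℓ m f (fun i => (a i : ℝ) / N) D -
      gaussSmooth (∑ i, ‖(a i : ℝ) / N‖₊ ^ 2) f 0| ≤ (ℓ + 1) * b := by
  set z : Fin (2 ^ ℓ) → ℝ := fun i => (a i : ℝ) / N with hz
  let S : ℕ → Set (Fin (2 ^ ℓ)) := fun s => {i | ℓ < s ∨ (N : ℤ) ^ 2 < 2 ^ s * a i ^ 2}
  let Φ : ℕ → ℝ := fun s =>
    rhtAvg ℓ m (gaussSmooth (∑ i, ‖(S s)ᶜ.indicator z i‖₊ ^ 2) f) ((S s).indicator z) D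
  have hle : ∀ i, a i ^ 2 ≤ (N : ℤ) ^ 2 := fun i =>
    (Finset.single_le_sum (fun i _ => sq_nonneg (a i)) (Finset.mem_univ i)).trans ha
  have hstep : ∀ s ≤ ℓ, |Φ (s + 1) - Φ s| ≤ b := by
    intro s hs
    have hSs : ∀ i, i ∈ S s ↔ (N : ℤ) ^ 2 < 2 ^ s * a i ^ 2 := fun i => by
      simp [S, not_lt.2 hs]
    have hmono : ∀ i, i ∈ S s → i ∈ S (s + 1) := by
      intro i hi
      rw [hSs] at hi
      right
      have hp : (2 : ℤ) ^ (s + 1) = 2 * 2 ^ s := pow_succ' 2 s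
      rw [hp]
      nlinarith [mul_nonneg (pow_pos (two_pos : (0 : ℤ) < 2) s).le (sq_nonneg (a i))]
    set w : Fin (2 ^ ℓ) → ℤ := (S (s + 1)).indicator a with hw
    set n : ℕ := ∑ i, ((S (s + 1))ᶜ.indicator a i).natAbs ^ 2 with hn
    have hwz : (fun i => (w i : ℝ) / N) = (S (s + 1)).indicator z := by
      ext i
      by_cases hi : i ∈ S (s + 1) <;> simp [hw, hz, hi]
    have hwabs : ∀ i, |w i| ≤ N := by
      intro i
      have h1 : |a i| ≤ N := abs_le_of_sq_le_sq (hle i) (by positivity)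
      by_cases hi : i ∈ S (s + 1)
      · simpa [hw, hi] using h1
      · simp [hw, hi]
    have hwcard : (Finset.univ.filter fun i => w i ≠ 0).card ≤ 2 ^ (s + 1) := by
      rcases hs.lt_or_eq with hlt | rfl
      · have hsub : (Finset.univ.filter fun i => w i ≠ 0)
            ⊆ Finset.univ.filter fun i => (N : ℤ) ^ 2 ≤ 2 ^ (s + 1) * a i ^ 2 := by
          intro i hi
          simp only [Finset.mem_filter, Finset.mem_univ, true_and, hw] at hi ⊢
          rcases Set.mem_of_indicator_ne_zero hi with h | h
          · omega
          · exact h.le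
        have hsum : ((Finset.univ.filter fun i => w i ≠ 0).card : ℤ) * (N : ℤ) ^ 2
            ≤ 2 ^ (s + 1) * (N : ℤ) ^ 2 := by
          calc ((Finset.univ.filter fun i => w i ≠ 0).card : ℤ) * (N : ℤ) ^ 2
              = ∑ i ∈ Finset.univ.filter (fun i => w i ≠ 0), (N : ℤ) ^ 2 := by simp
            _ ≤ ∑ i ∈ Finset.univ.filter (fun i => w i ≠ 0), 2 ^ (s + 1) * a i ^ 2 :=
                Finset.sum_le_sum fun i hi => (Finset.mem_filter.1 (hsub hi)).2
            _ ≤ ∑ i, 2 ^ (s + 1) * a i ^ 2 :=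
                Finset.sum_le_sum_of_subset_of_nonneg (Finset.subset_univ _)
                  fun i _ _ => by positivity
            _ ≤ 2 ^ (s + 1) * (N : ℤ) ^ 2 := by
                rw [← Finset.mul_sum]
                exact mul_le_mul_of_nonneg_left ha (by positivity)
        exact_mod_cast le_of_mul_le_mul_right hsum (by positivity)
      · refine (Finset.card_le_univ _).trans ?_
        rw [Fintype.card_fin]
        exact Nat.pow_le_pow_right two_pos (Nat.le_succ _)
    have hnN : n ≤ N ^ 2 := by
      have h1 : (n : ℤ) ≤ ∑ i, a i ^ 2 := by
        rw [hn]
        push_cast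
        refine Finset.sum_le_sum fun i _ => ?_
        by_cases hi : i ∈ S (s + 1)
        · simpa [hi] using sq_nonneg (a i)
        · simp [hi]
      exact_mod_cast h1.trans ha
    have hq : (n / (N : ℝ≥0) ^ 2 : ℝ≥0) = ∑ i, ‖(S (s + 1))ᶜ.indicator z i‖₊ ^ 2 := by
      rw [hn]
      push_cast
      rw [Finset.sum_div]
      refine Finset.sum_congr rfl fun i _ => ?_
      by_cases hi : i ∈ S (s + 1)
      · simp [hi]
      · refine NNReal.eq ?_
        simp [hi, hz, div_pow, Nat.cast_natAbs]
    have hmain := H s hs w hwabs hwcard n hnN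
    rw [gaussSmooth_gaussSmooth hf, hwz, hq, ← Finset.sum_add_distrib] at hmain
    set V : Set (Fin (2 ^ ℓ)) := {i | 2 ^ s * w i ^ 2 ≤ (N : ℤ) ^ 2} with hV
    have hVS : ∀ i, i ∈ V ↔ i ∉ S s := by
      intro i
      rw [hSs, not_lt, hV, Set.mem_ofPred_eq]
      by_cases hi : i ∈ S (s + 1)
      · simp [hw, hi]
      · have h0 : w i = 0 := by simp [hw, hi]
        have h1 := mt (hmono i) hi
        rw [hSs, not_lt] at h1
        simp [h0, h1]
    have hu : Vᶜ.indicator ((S (s + 1)).indicator z) = (S s).indicator z := by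
      rw [Set.indicator_indicator]
      congr 1
      ext i
      simp only [Set.mem_inter_iff, Set.mem_compl_iff, hVS, not_not]
      exact ⟨fun h => h.1, fun h => ⟨h, hmono i h⟩⟩
    have hsum : ∀ i, ‖V.indicator ((S (s + 1)).indicator z) i‖₊ ^ 2 +
        ‖(S (s + 1))ᶜ.indicator z i‖₊ ^ 2 = ‖(S s)ᶜ.indicator z i‖₊ ^ 2 := by
      intro i
      rw [Set.indicator_indicator]
      refine nnnorm_indicator_sq_add ?_ fun h => h.2 h.1.2
      simp only [Set.mem_inter_iff, Set.mem_compl_iff, hVS]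
      have := hmono i
      tauto
    rw [hu, Finset.sum_congr rfl fun i _ => hsum i] at hmain
    exact hmain
  have htel : ∀ s ≤ ℓ + 1, |Φ s - Φ 0| ≤ s * b := by
    intro s
    induction s with
    | zero => simp
    | succ s ih =>
      intro hs
      have h1 := abs_le.1 (ih (by omega))
      have h2 := abs_le.1 (hstep s (by omega))
      push_cast
      rw [abs_le]
      constructor <;> linarith [h1.1, h1.2, h2.1, h2.2]
  have hSlast : S (ℓ + 1) = Set.univ := Set.eq_univ_of_forall fun i => Or.inl (Nat.lt_succ_self ℓ)
  have hSzero : S 0 = ∅ := by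
    refine Set.eq_empty_of_forall_notMem fun i hi => ?_
    rcases hi with h | h
    · exact absurd h (Nat.not_lt_zero _)
    · rw [pow_zero, one_mul] at h
      exact absurd (hle i) (not_le.2 h)
  have hlast : Φ (ℓ + 1) = rhtAvg ℓ m f z D := by
    simp [Φ, hSlast, gaussSmooth_zero]
  have hzero : Φ 0 = gaussSmooth (∑ i, ‖z i‖₊ ^ 2) f 0 := by
    simp only [Φ, hSzero, Set.indicator_empty', rhtAvg_zero hm, Set.compl_empty, Set.indicator_univ]
  have h := htel (ℓ + 1) le_rfl
  rw [hlast, hzero] at h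
  push_cast at h
  exact h

end Net

section Uniform

variable {ℓ m : ℕ} {f : ℝ → ℝ}

lemma isProbabilityMeasure_diagMeasure (ℓ m : ℕ) : IsProbabilityMeasure (diagMeasure ℓ m) := by
  rw [diagMeasure]
  infer_instance

/-- The event that replacing the smallest entries of `w / N` by Gaussian smoothing of variance
`n / N ^ 2` fails to be accurate up to `b`. -/
def smoothingFailure (ℓ m : ℕ) (f : ℝ → ℝ) (N : ℕ) (b : ℝ) (s : ℕ) (w : Fin (2 ^ ℓ) → ℤ) (n : ℕ) :
    Set (Fin m → Fin (2 ^ ℓ) → ℝ) :=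
  {D | b < |rhtAvg ℓ m (gaussSmooth (n / (N : ℝ≥0) ^ 2) f) (fun i => (w i : ℝ) / N) D -
    rhtAvg ℓ m (gaussSmooth (∑ i, ‖{i | 2 ^ s * w i ^ 2 ≤ (N : ℤ) ^ 2}.indicator
      (fun i => (w i : ℝ) / N) i‖₊ ^ 2) (gaussSmooth (n / (N : ℝ≥0) ^ 2) f))
      ({i | 2 ^ s * w i ^ 2 ≤ (N : ℤ) ^ 2}ᶜ.indicator fun i => (w i : ℝ) / N) D|}

lemma diagMeasure_smoothingFailure_le (hm : 0 < m) (hf : LipschitzWith 1 f) {N : ℕ} (hN : 0 < N)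
    {b : ℝ} (hb : 0 ≤ b) {P : ℕ} (hP : 0 < P) (hmb : 40 * Real.log P ≤ m * b ^ 2) (s : ℕ)
    (w : Fin (2 ^ ℓ) → ℤ) (n : ℕ) :
    diagMeasure ℓ m (smoothingFailure ℓ m f N b s w n)
      ≤ ENNReal.ofReal (2 * ((P : ℝ) ^ 2 ^ (s + 3))⁻¹) := by
  have hN' : (0 : ℝ) < N := by exact_mod_cast hN
  refine (diagMeasure_tail_le (K := (2 ^ s)⁻¹) hm (lipschitz_gaussSmooth hf _) _ _
    (fun i hi => ?_) (by positivity) hb).trans ?_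
  · have hi' : (2 : ℝ) ^ s * (w i : ℝ) ^ 2 ≤ (N : ℝ) ^ 2 := by exact_mod_cast hi
    rw [div_pow, div_le_iff₀ (by positivity), inv_mul_eq_div, le_div_iff₀ (by positivity)]
    linarith
  · rw [ENNReal.ofReal_mul zero_le_two, ENNReal.ofReal_ofNat]
    gcongr
    have hP' : (0 : ℝ) < P := by exact_mod_cast hP
    rw [← Real.exp_log (by positivity : 0 < (P : ℝ) ^ 2 ^ (s + 3)), ← Real.exp_neg, Real.log_pow,
      Real.exp_le_exp, neg_le_neg_iff, le_div_iff₀ (by positivity)]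
    push_cast
    have h2 : (2 : ℝ) ^ (s + 3) = 8 * 2 ^ s := by ring
    have h3 : (2 : ℝ) ^ s * (2 ^ s)⁻¹ = 1 := mul_inv_cancel₀ (by positivity)
    calc (2 : ℝ) ^ (s + 3) * Real.log P * (5 * (2 ^ s)⁻¹)
        = 40 * Real.log P * (2 ^ s * (2 ^ s)⁻¹) := by rw [h2]; ring
      _ ≤ m * b ^ 2 := by rw [h3, mul_one]; exact hmb

/-- Union bound over the net of sparse integer vectors. -/
lemma diagMeasure_exists_smoothingFailure_le (hm : 0 < m) (hf : LipschitzWith 1 f) {N : ℕ}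
    (hN : 0 < N) {b : ℝ} (hb : 0 ≤ b)
    (hmb : 40 * Real.log ((2 ^ ℓ * (2 * N + 1) : ℕ) : ℝ) ≤ m * b ^ 2) :
    diagMeasure ℓ m {D | ∃ s ≤ ℓ, ∃ w : Fin (2 ^ ℓ) → ℤ, (∀ i, |w i| ≤ N) ∧
      (Finset.univ.filter fun i => w i ≠ 0).card ≤ 2 ^ (s + 1) ∧ ∃ n ≤ N ^ 2,
        D ∈ smoothingFailure ℓ m f N b s w n}
      ≤ ENNReal.ofReal (2 * (ℓ + 1) / (2 ^ ℓ * (2 * N + 1))) := by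
  set P : ℕ := 2 ^ ℓ * (2 * N + 1) with hP
  have hP0 : 0 < P := by positivity
  have hP1 : (1 : ℝ) ≤ P := by exact_mod_cast hP0
  choose W hWcard hWmem using fun s : ℕ => exists_finset_sparse (Fin (2 ^ ℓ)) N (2 ^ (s + 1))
  have hcard : ∀ s, ((W s).card : ℝ) * (N ^ 2 + 1 : ℕ) ≤ (P : ℝ) ^ 2 ^ (s + 2) := by
    intro s
    have h1 : (W s).card ≤ P ^ 2 ^ (s + 1) := by simpa [hP] using hWcard s
    have h2 : N ^ 2 + 1 ≤ P ^ 2 ^ (s + 1) := by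
      have h3 : 2 * N + 1 ≤ P := Nat.le_mul_of_pos_left _ (by positivity)
      calc N ^ 2 + 1 ≤ (2 * N + 1) ^ 2 := by nlinarith
        _ ≤ P ^ 2 := Nat.pow_le_pow_left h3 2
        _ ≤ P ^ 2 ^ (s + 1) := Nat.pow_le_pow_right hP0 (by
            rw [pow_succ]; exact Nat.le_mul_of_pos_left 2 (by positivity))
    have h4 : (W s).card * (N ^ 2 + 1) ≤ P ^ 2 ^ (s + 2) := by
      refine (Nat.mul_le_mul h1 h2).trans (le_of_eq ?_)
      rw [← pow_add]
      congr 1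
      ring
    exact_mod_cast h4
  have hlevel : ∀ s, ((W s).card : ℝ) * (N ^ 2 + 1 : ℕ) * (2 * ((P : ℝ) ^ 2 ^ (s + 3))⁻¹)
      ≤ 2 / P := by
    intro s
    have hexp : 2 ^ (s + 2) + 1 ≤ 2 ^ (s + 3) := by
      have : 0 < 2 ^ s := by positivity
      rw [pow_add, pow_add]
      omega
    have hpow : (P : ℝ) ^ 2 ^ (s + 2) * P ≤ (P : ℝ) ^ 2 ^ (s + 3) := by
      rw [← pow_succ]
      exact pow_le_pow_right₀ hP1 hexp
    calc ((W s).card : ℝ) * (N ^ 2 + 1 : ℕ) * (2 * ((P : ℝ) ^ 2 ^ (s + 3))⁻¹)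
        ≤ (P : ℝ) ^ 2 ^ (s + 2) * (2 * ((P : ℝ) ^ 2 ^ (s + 3))⁻¹) := by gcongr; exact hcard s
      _ ≤ 2 / P := by
        rw [← mul_assoc, ← div_eq_mul_inv, div_le_div_iff₀ (by positivity) (by positivity)]
        linarith
  calc _ ≤ diagMeasure ℓ m (⋃ s ∈ Finset.range (ℓ + 1), ⋃ p ∈ W s ×ˢ Finset.range (N ^ 2 + 1),
          smoothingFailure ℓ m f N b s p.1 p.2) := by
        refine measure_mono ?_
        rintro D ⟨s, hs, w, hw, hwc, n, hn, hD⟩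
        simp only [Set.mem_iUnion]
        exact ⟨s, Finset.mem_range.2 (by omega), (w, n),
          Finset.mem_product.2 ⟨hWmem s w hw hwc, Finset.mem_range.2 (by omega)⟩, hD⟩
    _ ≤ ∑ s ∈ Finset.range (ℓ + 1), ∑ p ∈ W s ×ˢ Finset.range (N ^ 2 + 1),
          diagMeasure ℓ m (smoothingFailure ℓ m f N b s p.1 p.2) :=
        (measure_biUnion_finset_le _ _).trans
          (Finset.sum_le_sum fun s _ => measure_biUnion_finset_le _ _)
    _ ≤ ∑ s ∈ Finset.range (ℓ + 1), ENNReal.ofReal (2 / P) := by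
        refine Finset.sum_le_sum fun s _ => ?_
        refine (Finset.sum_le_sum fun p _ =>
          diagMeasure_smoothingFailure_le hm hf hN hb hP0 hmb s p.1 p.2).trans ?_
        rw [Finset.sum_const, nsmul_eq_mul, ← ENNReal.ofReal_natCast,
          ← ENNReal.ofReal_mul (by positivity), Finset.card_product, Finset.card_range]
        refine ENNReal.ofReal_le_ofReal ?_
        have h := hlevel s
        rwa [← Nat.cast_mul] at h
    _ = ENNReal.ofReal (2 * (ℓ + 1) / (2 ^ ℓ * (2 * N + 1))) := by
        rw [Finset.sum_const, nsmul_eq_mul, ← ENNReal.ofReal_natCast,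
          ← ENNReal.ofReal_mul (by positivity), Finset.card_range, hP]
        congr 1
        push_cast
        ring

/-- Markov's inequality for the sum of the absolute values of all diagonal entries. -/
lemma diagMeasure_sum_abs_le (ℓ m : ℕ) {c : ℝ} (hc : 0 < c) :
    diagMeasure ℓ m {D | c ≤ ∑ j, ∑ i, |D j i|} ≤ ENNReal.ofReal (m * 2 ^ ℓ / c) := by
  have hentry : ∀ (j : Fin m) (i : Fin (2 ^ ℓ)),
      ∫⁻ D, ENNReal.ofReal |D j i| ∂diagMeasure ℓ m ≤ 1 := by
    intro j i
    have hmp : MeasurePreserving (fun D : Fin m → Fin (2 ^ ℓ) → ℝ => D j i) (diagMeasure ℓ m)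
        (gaussianReal 0 1) :=
      (measurePreserving_eval (fun _ : Fin (2 ^ ℓ) => gaussianReal 0 1) i).comp
        (measurePreserving_eval
          (fun _ : Fin m => Measure.pi fun _ : Fin (2 ^ ℓ) => gaussianReal 0 1) j)
    rw [hmp.lintegral_comp (f := fun x => ENNReal.ofReal |x|) (by fun_prop),
      ← ofReal_integral_eq_lintegral_ofReal (f := fun x => |x|) (integrable_id_gaussianReal 1).abs
        (Filter.Eventually.of_forall fun x => abs_nonneg x)]
    exact ENNReal.ofReal_le_one.2 integral_abs_gaussianReal_le
  have hInt : ∫⁻ D, ENNReal.ofReal (∑ j, ∑ i, |D j i|) ∂diagMeasure ℓ m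
      ≤ ENNReal.ofReal (m * 2 ^ ℓ) := by
    have hsplit : ∀ D : Fin m → Fin (2 ^ ℓ) → ℝ, ENNReal.ofReal (∑ j, ∑ i, |D j i|)
        = ∑ j, ∑ i, ENNReal.ofReal |D j i| := by
      intro D
      rw [ENNReal.ofReal_sum_of_nonneg fun j _ => Finset.sum_nonneg fun i _ => abs_nonneg _]
      exact Finset.sum_congr rfl fun j _ =>
        ENNReal.ofReal_sum_of_nonneg fun i _ => abs_nonneg _
    simp_rw [hsplit]
    rw [lintegral_finsetSum _ fun j _ => by fun_prop]
    calc _ ≤ ∑ _j : Fin m, ∑ _i : Fin (2 ^ ℓ), (1 : ℝ≥0∞) := by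
          refine Finset.sum_le_sum fun j _ => ?_
          rw [lintegral_finsetSum _ fun i _ => by fun_prop]
          exact Finset.sum_le_sum fun i _ => hentry j i
      _ = ENNReal.ofReal (m * 2 ^ ℓ) := by
          rw [ENNReal.ofReal_mul (by positivity), ENNReal.ofReal_pow zero_le_two]
          simp
  rw [ENNReal.ofReal_div_of_pos hc,
    ENNReal.le_div_iff_mul_le (Or.inl (by simpa using hc)) (Or.inl ENNReal.ofReal_ne_top), mul_comm]
  refine le_trans ?_ ((mul_meas_ge_le_lintegral (μ := diagMeasure ℓ m)
    (f := fun D => ENNReal.ofReal (∑ j, ∑ i, |D j i|)) (by fun_prop) (ENNReal.ofReal c)).trans hInt)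
  gcongr
  exact fun hD => ENNReal.ofReal_le_ofReal hD

lemma abs_rhtAvg_sub_rhtAvg_le (hm : 0 < m) (hf : LipschitzWith 1 f) {η : ℝ}
    {z z' : Fin (2 ^ ℓ) → ℝ} (hz : ∀ i, |z i - z' i| ≤ η) (D : Fin m → Fin (2 ^ ℓ) → ℝ) :
    |rhtAvg ℓ m f z D - rhtAvg ℓ m f z' D| ≤ (m : ℝ)⁻¹ * (∑ j, ∑ i, |D j i|) * η := by
  have hblock : ∀ x k, |f (hadBlock ℓ z x k) - f (hadBlock ℓ z' x k)| ≤ ∑ i, |x i| * η := by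
    intro x k
    refine (abs_sub_le_of_lipschitz hf _ _).trans ?_
    rw [hadBlock_eq_sum, hadBlock_eq_sum, ← Finset.sum_sub_distrib]
    refine (Finset.abs_sum_le_sum_abs _ _).trans (Finset.sum_le_sum fun i _ => ?_)
    rw [← sub_mul, ← mul_sub, abs_mul, abs_mul, abs_had, one_mul, mul_comm]
    exact mul_le_mul_of_nonneg_left (hz i) (abs_nonneg _)
  rw [rhtAvg, rhtAvg, ← mul_sub, ← Finset.sum_sub_distrib, abs_mul,
    abs_of_pos (by positivity : (0 : ℝ) < (m : ℝ)⁻¹), mul_assoc]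
  refine mul_le_mul_of_nonneg_left ?_ (by positivity)
  rw [Finset.sum_mul]
  refine (Finset.abs_sum_le_sum_abs _ _).trans (Finset.sum_le_sum fun j _ => ?_)
  rw [hadAvg, hadAvg, ← mul_sub, ← Finset.sum_sub_distrib, Finset.sum_mul]
  exact abs_inv_mul_sum_le ℓ fun k => hblock _ k

/-- Rounding a real number towards zero to a multiple of `1 / N`. -/
lemma exists_int_div_near {N : ℕ} (hN : 0 < N) (x : ℝ) :
    ∃ a : ℤ, |(a : ℝ) / N| ≤ |x| ∧ |x - a / N| ≤ 1 / N := by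
  have hN' : (0 : ℝ) < N := by exact_mod_cast hN
  suffices h : ∃ a : ℤ, |(a : ℝ)| ≤ |x * N| ∧ |x * N - a| ≤ 1 by
    obtain ⟨a, h1, h2⟩ := h
    refine ⟨a, ?_, ?_⟩
    · rw [abs_div, abs_of_pos hN', div_le_iff₀ hN']
      rwa [abs_mul, abs_of_pos hN'] at h1
    · have h3 : x - a / N = (x * N - a) / N := by field_simp
      rw [h3, abs_div, abs_of_pos hN']
      gcongr
  generalize x * N = y
  rcases le_total 0 y with hy | hy
  · have h1 := Int.floor_le y
    have h2 := Int.lt_floor_add_one y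
    have h3 : (0 : ℝ) ≤ ⌊y⌋ := by exact_mod_cast Int.floor_nonneg.2 hy
    refine ⟨⌊y⌋, by rwa [abs_of_nonneg h3, abs_of_nonneg hy], abs_le.2 ⟨?_, ?_⟩⟩ <;> linarith
  · have h1 := Int.le_ceil y
    have h2 := Int.ceil_lt_add_one y
    have h3 : (⌈y⌉ : ℝ) ≤ 0 := by exact_mod_cast Int.ceil_nonpos.2 hy
    refine ⟨⌈y⌉, ?_, abs_le.2 ⟨?_, ?_⟩⟩
    · rw [abs_of_nonpos h3, abs_of_nonpos hy]
      linarith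
    all_goals linarith

lemma inv_mul_sum_rht_eq_rhtAvg (f : ℝ → ℝ) (D : Fin m → Fin (2 ^ ℓ) → ℝ)
    (z : EuclideanSpace ℝ (Fin (2 ^ ℓ))) :
    1 / ((m : ℝ) * 2 ^ ℓ) * ∑ j, ∑ k, f (rht ℓ m D z j k) = rhtAvg ℓ m f (fun i => z i) D := by
  simp only [rhtAvg, hadAvg, ← Finset.mul_sum]
  rw [← mul_assoc, one_div, mul_inv]
  rfl

/-- Passing from the net to the whole unit ball. -/
lemma abs_rhtAvg_sub_le_of_net (hm : 0 < m) (hf : LipschitzWith 1 f) {N : ℕ} (hN : 0 < N)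
    {q r : ℝ} {D : Fin m → Fin (2 ^ ℓ) → ℝ}
    (hD : (m : ℝ)⁻¹ * (∑ j, ∑ i, |D j i|) ≤ q)
    (hnet : ∀ a : Fin (2 ^ ℓ) → ℤ, ∑ i, a i ^ 2 ≤ (N : ℤ) ^ 2 →
      |rhtAvg ℓ m f (fun i => (a i : ℝ) / N) D -
        gaussSmooth (∑ i, ‖(a i : ℝ) / N‖₊ ^ 2) f 0| ≤ r)
    (z : EuclideanSpace ℝ (Fin (2 ^ ℓ))) (hz : ‖z‖ ≤ 1) :
    |rhtAvg ℓ m f (fun i => z i) D - gaussSmooth (‖z‖₊ ^ 2) f 0| ≤ q / N + r + 2 ^ ℓ / N := by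
  have hN' : (0 : ℝ) < N := by exact_mod_cast hN
  choose a ha1 ha2 using fun i => exists_int_div_near hN (z i)
  set z' : EuclideanSpace ℝ (Fin (2 ^ ℓ)) := WithLp.toLp 2 fun i => (a i : ℝ) / N with hz'
  have hsum : ∑ i, a i ^ 2 ≤ (N : ℤ) ^ 2 := by
    have h1 : ∑ i, ((a i : ℝ) / N) ^ 2 ≤ 1 := by
      calc ∑ i, ((a i : ℝ) / N) ^ 2 ≤ ∑ i, z i ^ 2 :=
            Finset.sum_le_sum fun i _ => sq_le_sq.2 (ha1 i)
        _ = ‖z‖ ^ 2 := (EuclideanSpace.real_norm_sq_eq z).symm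
        _ ≤ 1 := pow_le_one₀ (norm_nonneg z) hz
    simp_rw [div_pow] at h1
    rw [← Finset.sum_div, div_le_one (by positivity)] at h1
    exact_mod_cast h1
  have hnorm : (∑ i, ‖(a i : ℝ) / N‖₊ ^ 2 : ℝ≥0) = ‖z'‖₊ ^ 2 := by
    refine NNReal.eq ?_
    push_cast
    rw [EuclideanSpace.norm_sq_eq]
  have hdist : ‖z - z'‖ ≤ 2 ^ ℓ / N := by
    have h1 : ‖z - z'‖ ≤ ∑ i, |z i - a i / N| := by
      rw [EuclideanSpace.norm_eq]
      refine Real.sqrt_le_iff.2 ⟨Finset.sum_nonneg fun i _ => abs_nonneg _, ?_⟩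
      exact Finset.sum_sq_le_sq_sum_of_nonneg fun i _ => abs_nonneg _
    refine h1.trans ((Finset.sum_le_sum fun i _ => ha2 i).trans (le_of_eq ?_))
    simp [div_eq_mul_inv]
  have h1 : |rhtAvg ℓ m f (fun i => z i) D - rhtAvg ℓ m f (fun i => (a i : ℝ) / N) D| ≤ q / N := by
    refine (abs_rhtAvg_sub_rhtAvg_le hm hf ha2 D).trans ?_
    rw [mul_one_div]
    gcongr
  have h2 := hnet a hsum
  rw [hnorm] at h2
  have h3 : |gaussSmooth (‖z'‖₊ ^ 2) f 0 - gaussSmooth (‖z‖₊ ^ 2) f 0| ≤ 2 ^ ℓ / N := by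
    refine (abs_gaussSmooth_sq_sub_le hf _ _).trans ?_
    rw [coe_nnnorm, coe_nnnorm, abs_sub_comm]
    exact (abs_norm_sub_norm_le z z').trans hdist
  rw [abs_le] at *
  constructor <;> linarith [h1.1, h1.2, h2.1, h2.2, h3.1, h3.2]

lemma forty_mul_log_le {d ε δ L μ : ℝ} {N : ℕ} (hε : ε ∈ Set.Ioo (0 : ℝ) (1 / 2))
    (hδ : δ ∈ Set.Ioo (0 : ℝ) (1 / 2)) (hd : 1 ≤ d) (hL : 1 ≤ L)
    (hLd : L * Real.log 2 ≤ Real.log (d / ε)) (hN : (N : ℝ) ≤ 9 * d / (δ * ε)) (hN1 : 1 ≤ N)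
    (hμ : 40960 * ε⁻¹ ^ 2 * Real.log (d / ε) ^ 5 * Real.log (1 / δ) ≤ μ) :
    40 * Real.log (d * (2 * N + 1)) ≤ μ * (ε / (2 * L)) ^ 2 := by
  obtain ⟨hε0, hε1⟩ := hε
  obtain ⟨hδ0, hδ1⟩ := hδ
  have hlog2 : 1 / 2 ≤ Real.log 2 := by linarith [Real.log_two_gt_d9]
  set Λ := Real.log (d / ε) with hΛ
  set lam := Real.log (1 / δ) with hlam
  have hΛL : L ≤ 2 * Λ := by nlinarith
  have hΛ2 : Real.log 2 ≤ Λ := by nlinarith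
  have hlam2 : Real.log 2 ≤ lam :=
    Real.log_le_log two_pos (by rw [le_div_iff₀ hδ0]; linarith)
  have hN1' : (1 : ℝ) ≤ N := by exact_mod_cast hN1
  have hP : d * (2 * N + 1) ≤ 2 ^ 5 * (d / ε) ^ 2 * (1 / δ) := by
    calc d * (2 * N + 1) ≤ d * (3 * N) := by gcongr; linarith
      _ ≤ d * (3 * (9 * d / (δ * ε))) := by gcongr
      _ = 27 * ε * ((d / ε) ^ 2 * (1 / δ)) := by field_simp; ring
      _ ≤ 2 ^ 5 * ((d / ε) ^ 2 * (1 / δ)) := by gcongr; linarith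
      _ = _ := by ring
  have hlogP : Real.log (d * (2 * N + 1)) ≤ 5 * Real.log 2 + 2 * Λ + lam := by
    refine (Real.log_le_log (by positivity) hP).trans (le_of_eq ?_)
    rw [Real.log_mul (by positivity) (by positivity), Real.log_mul (by positivity) (by positivity),
      Real.log_pow, Real.log_pow]
    push_cast
    rfl
  have hΛhalf : 1 / 2 ≤ Λ := hlog2.trans hΛ2
  have hlamhalf : 1 / 2 ≤ lam := hlog2.trans hlam2
  have hlogP' : Real.log (d * (2 * N + 1)) ≤ 16 * (Λ * lam) := by
    have h1 : Λ ≤ 2 * (Λ * lam) := by nlinarith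
    have h2 : lam ≤ 2 * (Λ * lam) := by nlinarith
    linarith
  have hΛlam : 0 ≤ Λ * lam := by positivity
  calc 40 * Real.log (d * (2 * N + 1)) ≤ 640 * (Λ * lam) := by linarith
    _ ≤ 640 * (Λ * lam) * (4 * Λ ^ 2) := by
        refine le_mul_of_one_le_right (by positivity) ?_
        nlinarith
    _ = 640 * (Λ * lam) * (4 * Λ ^ 2) * (4 * (2 * Λ) ^ 2) / (4 * (2 * Λ) ^ 2) := by
        rw [mul_div_cancel_right₀ _ (by positivity)]
    _ ≤ 640 * (Λ * lam) * (4 * Λ ^ 2) * (4 * (2 * Λ) ^ 2) / (4 * L ^ 2) := by gcongr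
    _ = 40960 * ε⁻¹ ^ 2 * Λ ^ 5 * lam * (ε / (2 * L)) ^ 2 := by field_simp; ring
    _ ≤ μ * (ε / (2 * L)) ^ 2 := by gcongr

end Uniform

/-- Theorem 1.1: uniform Lipschitz concentration for randomized
Hadamard transforms. -/
theorem uniform_lipschitz_concentration_rht :
    ∃ C : ℝ, 0 < C ∧
      ∀ (ℓ : ℕ) (ε δ : ℝ), ε ∈ Set.Ioo (0 : ℝ) (1 / 2) → δ ∈ Set.Ioo (0 : ℝ) (1 / 2) →
        ∀ f : ℝ → ℝ, LipschitzWith 1 f →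
          ∀ m : ℕ,
            C * ε⁻¹ ^ 2 * Real.log (2 ^ ℓ / ε) ^ 5 * Real.log (1 / δ) ≤ (m : ℝ) →
            ENNReal.ofReal (1 - δ) ≤
              diagMeasure ℓ m
                {D | ∀ z : EuclideanSpace ℝ (Fin (2 ^ ℓ)), ‖z‖ ≤ 1 →
                  |(1 / ((m : ℝ) * 2 ^ ℓ)) * ∑ j, ∑ k, f (rht ℓ m D z j k) -
                      ∫ x, f x ∂(gaussianReal 0 (‖z‖₊ ^ 2))| ≤ ε} := by
  refine ⟨40960, by norm_num, fun ℓ ε δ hε hδ f hf m hmle => ?_⟩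
  have hε0 : 0 < ε := hε.1
  have hδ0 : 0 < δ := hδ.1
  have hε1 : ε < 1 / 2 := hε.2
  have hδ1 : δ < 1 / 2 := hδ.2
  have hd1 : (1 : ℝ) ≤ 2 ^ ℓ := one_le_pow₀ one_le_two
  have hlog2 : 0 < Real.log 2 := Real.log_pos one_lt_two
  have hLd : (ℓ + 1 : ℝ) * Real.log 2 ≤ Real.log (2 ^ ℓ / ε) := by
    have h : (2 : ℝ) ^ (ℓ + 1) ≤ 2 ^ ℓ / ε := by
      rw [le_div_iff₀ hε0, pow_succ]
      nlinarith
    have h' := Real.log_le_log (by positivity) h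
    rw [Real.log_pow] at h'
    exact_mod_cast h'
  have hlogd : 0 < Real.log (2 ^ ℓ / ε) := lt_of_lt_of_le (by positivity) hLd
  have hlogδ : 0 < Real.log (1 / δ) := Real.log_pos (by rw [lt_div_iff₀ hδ0]; linarith)
  have hm' : (0 : ℝ) < m := lt_of_lt_of_le (by positivity) hmle
  have hm : 0 < m := by exact_mod_cast hm'
  set N : ℕ := ⌈8 * 2 ^ ℓ / (δ * ε)⌉₊ with hNdef
  have hNge : 8 * 2 ^ ℓ / (δ * ε) ≤ N := Nat.le_ceil _
  have hone : 1 ≤ 2 ^ ℓ / (δ * ε) := by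
    rw [le_div_iff₀ (by positivity)]
    nlinarith
  have hNle : (N : ℝ) ≤ 9 * 2 ^ ℓ / (δ * ε) := by
    have h1 := (Nat.ceil_lt_add_one (by positivity : 0 ≤ 8 * 2 ^ ℓ / (δ * ε))).le
    have h2 : 9 * 2 ^ ℓ / (δ * ε) = 8 * 2 ^ ℓ / (δ * ε) + 2 ^ ℓ / (δ * ε) := by ring
    linarith
  have hN' : (0 : ℝ) < N := lt_of_lt_of_le (by positivity) hNge
  have hN : 0 < N := by exact_mod_cast hN'
  have hNδε : 8 * 2 ^ ℓ ≤ N * (δ * ε) := (div_le_iff₀ (by positivity)).1 hNge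
  set b : ℝ := ε / (2 * (ℓ + 1)) with hb
  have hb0 : 0 ≤ b := by positivity
  have hmb : 40 * Real.log ((2 ^ ℓ * (2 * N + 1) : ℕ) : ℝ) ≤ m * b ^ 2 := by
    push_cast
    exact forty_mul_log_le hε hδ hd1 (by linarith [(Nat.cast_nonneg ℓ : (0 : ℝ) ≤ ℓ)]) hLd hNle hN
      hmle
  set Good := {D : Fin m → Fin (2 ^ ℓ) → ℝ | ∀ z : EuclideanSpace ℝ (Fin (2 ^ ℓ)), ‖z‖ ≤ 1 →
    |(1 / ((m : ℝ) * 2 ^ ℓ)) * ∑ j, ∑ k, f (rht ℓ m D z j k) -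
      ∫ x, f x ∂(gaussianReal 0 (‖z‖₊ ^ 2))| ≤ ε} with hGood
  set Bad := {D : Fin m → Fin (2 ^ ℓ) → ℝ | ∃ s ≤ ℓ, ∃ w : Fin (2 ^ ℓ) → ℤ, (∀ i, |w i| ≤ N) ∧
    (Finset.univ.filter fun i => w i ≠ 0).card ≤ 2 ^ (s + 1) ∧ ∃ n ≤ N ^ 2,
      D ∈ smoothingFailure ℓ m f N b s w n} with hBad
  set Large := {D : Fin m → Fin (2 ^ ℓ) → ℝ | m * (2 * 2 ^ ℓ / δ) ≤ ∑ j, ∑ i, |D j i|} with hLarge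
  have hBadle : diagMeasure ℓ m Bad ≤ ENNReal.ofReal (δ / 2) := by
    refine (diagMeasure_exists_smoothingFailure_le hm hf hN hb0 hmb).trans
      (ENNReal.ofReal_le_ofReal ?_)
    have hℓ : (ℓ + 1 : ℝ) ≤ 2 ^ ℓ := by exact_mod_cast Nat.lt_two_pow_self (n := ℓ)
    have hNδ : 8 ≤ N * δ := by nlinarith [mul_pos hN' hδ0]
    rw [div_le_iff₀ (by positivity)]
    nlinarith [mul_pos (lt_of_lt_of_le one_pos hd1) hδ0,
      mul_le_mul_of_nonneg_left hNδ (zero_le_one.trans hd1)]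
  have hLargele : diagMeasure ℓ m Large ≤ ENNReal.ofReal (δ / 2) := by
    refine (diagMeasure_sum_abs_le ℓ m (by positivity)).trans (le_of_eq ?_)
    congr 1
    field_simp
  have hcover : (Set.univ : Set (Fin m → Fin (2 ^ ℓ) → ℝ)) ⊆ Good ∪ (Bad ∪ Large) := by
    intro D _
    by_contra hD
    simp only [Set.mem_union, not_or] at hD
    obtain ⟨hDG, hDB, hDL⟩ := hD
    refine hDG fun z hz => ?_
    have hq : (m : ℝ)⁻¹ * (∑ j, ∑ i, |D j i|) ≤ 2 * 2 ^ ℓ / δ := by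
      rw [inv_mul_le_iff₀ hm']
      exact (not_le.1 hDL).le
    have hnet := abs_rhtAvg_sub_gaussSmooth_le (D := D) (b := b) hm hf hN
      fun s hs w hw hwc n hn => not_lt.1 fun hlt => hDB ⟨s, hs, w, hw, hwc, n, hn, hlt⟩
    have hmain := abs_rhtAvg_sub_le_of_net hm hf hN hq hnet z hz
    have hInt : ∫ x, f x ∂(gaussianReal 0 (‖z‖₊ ^ 2)) = gaussSmooth (‖z‖₊ ^ 2) f 0 := by
      simp [gaussSmooth]
    rw [inv_mul_sum_rht_eq_rhtAvg, hInt]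
    refine hmain.trans ?_
    have h1 : 2 * 2 ^ ℓ / δ / N ≤ ε / 4 := by
      rw [div_div, div_le_iff₀ (by positivity)]
      linarith
    have h2 : (2 : ℝ) ^ ℓ / N ≤ ε / 4 := by
      rw [div_le_iff₀ hN']
      nlinarith [mul_pos hN' hε0]
    have h3 : (ℓ + 1 : ℝ) * b = ε / 2 := by
      rw [hb]
      field_simp
    linarith
  have := isProbabilityMeasure_diagMeasure ℓ m
  have htotal : 1 ≤ diagMeasure ℓ m Good + ENNReal.ofReal δ := by
    calc (1 : ℝ≥0∞) = diagMeasure ℓ m Set.univ := measure_univ.symm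
      _ ≤ diagMeasure ℓ m (Good ∪ (Bad ∪ Large)) := measure_mono hcover
      _ ≤ diagMeasure ℓ m Good + (diagMeasure ℓ m Bad + diagMeasure ℓ m Large) :=
          (measure_union_le _ _).trans (add_le_add le_rfl (measure_union_le _ _))
      _ ≤ diagMeasure ℓ m Good + (ENNReal.ofReal (δ / 2) + ENNReal.ofReal (δ / 2)) := by gcongr
      _ = diagMeasure ℓ m Good + ENNReal.ofReal δ := by
          rw [← ENNReal.ofReal_add (by positivity) (by positivity), add_halves]
  rw [ENNReal.ofReal_sub _ hδ0.le, ENNReal.ofReal_one]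
  exact tsub_le_iff_right.2 htotal
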